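/- Let H be a connected 3-graph on n ≥ 8 vertices that is 𝒫₄-free, contains no copy of the minimal 4-cycle C₄, and contains no three pairwise disjoint edges. If H is isomorphic to a sub-3-graph of none of Sₙ^{+1}, SPₙ and CBₙ, then |H| ≤ max{4n − 11, C(n−4,2) + 10}. -/

import Mathlib

open Finset

/-- `H` is a 3-graph on the vertex set `V`: every edge is a 3-element subset of `V`. -/
def ThreeGraphOn (V : Finset ℕ) (H : Finset (Finset ℕ)) : Prop :=
  ∀ e ∈ H, e ⊆ V ∧ e.card = 3

/-- Four edges form a 3-uniform minimal 4-path: `aᵢ ∩ aⱼ ≠ ∅ ↔ |i - j| ≤ 1`. -/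
def IsMinPath4 (a₀ a₁ a₂ a₃ : Finset ℕ) : Prop :=
  (a₀ ∩ a₁).Nonempty ∧ (a₁ ∩ a₂).Nonempty ∧ (a₂ ∩ a₃).Nonempty ∧
    a₀ ∩ a₂ = ∅ ∧ a₀ ∩ a₃ = ∅ ∧ a₁ ∩ a₃ = ∅

/-- `H` contains no minimal 4-path. -/
def P4Free (H : Finset (Finset ℕ)) : Prop :=
  ¬∃ a₀ ∈ H, ∃ a₁ ∈ H, ∃ a₂ ∈ H, ∃ a₃ ∈ H, IsMinPath4 a₀ a₁ a₂ a₃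

/-- `H` is connected on `V`: every partition of `V` into two nonempty parts
is crossed by an edge of `H`. -/
def ConnectedHG (V : Finset ℕ) (H : Finset (Finset ℕ)) : Prop :=
  ∀ U W : Finset ℕ, U ∪ W = V → Disjoint U W → U.Nonempty → W.Nonempty →
    ∃ e ∈ H, (e ∩ U).Nonempty ∧ (e ∩ W).Nonempty

/-- `H` contains three pairwise disjoint edges. -/
def HasM3 (H : Finset (Finset ℕ)) : Prop :=
  ∃ e₁ ∈ H, ∃ e₂ ∈ H, ∃ e₃ ∈ H, e₁ ∩ e₂ = ∅ ∧ e₁ ∩ e₃ = ∅ ∧ e₂ ∩ e₃ = ∅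

/-- `H` contains a copy of the minimal 4-cycle `C₄`: six distinct vertices
with edges `{x₁,y₁,y₂}`, `{y₁,y₂,x₂}`, `{x₂,z₁,z₂}`, `{z₁,z₂,x₁}`. -/
def HasC4 (H : Finset (Finset ℕ)) : Prop :=
  ∃ x₁ x₂ y₁ y₂ z₁ z₂ : ℕ, ({x₁, x₂, y₁, y₂, z₁, z₂} : Finset ℕ).card = 6 ∧
    ({x₁, y₁, y₂} : Finset ℕ) ∈ H ∧ ({y₁, y₂, x₂} : Finset ℕ) ∈ H ∧
    ({x₂, z₁, z₂} : Finset ℕ) ∈ H ∧ ({z₁, z₂, x₁} : Finset ℕ) ∈ H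

/-- `H` is a starplus on `V`: a full star with center `v` together with one
extra 3-edge not containing `v`. -/
def IsStarPlusOn (V : Finset ℕ) (H : Finset (Finset ℕ)) : Prop :=
  ∃ v ∈ V, ∃ e : Finset ℕ, e ⊆ V ∧ e.card = 3 ∧ v ∉ e ∧
    H = (V.powersetCard 3).filter (fun t => v ∈ t) ∪ {e}

/-- `H` is (isomorphic to) a sub-3-graph of the starplus on `V`. -/
def SubStarPlus (V : Finset ℕ) (H : Finset (Finset ℕ)) : Prop :=
  ∃ H' : Finset (Finset ℕ), IsStarPlusOn V H' ∧ H ⊆ H'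

/-- `H` is the `P`-star `SPₙ` on `V`: a minimal 2-path `f₁, f₂` (two 3-edges
sharing exactly one vertex) together with all triples of `V` containing a
vertex `v` outside the path and at least one vertex of the path. -/
def IsSPOn (V : Finset ℕ) (H : Finset (Finset ℕ)) : Prop :=
  ∃ v ∈ V, ∃ f₁ f₂ : Finset ℕ, f₁ ⊆ V ∧ f₂ ⊆ V ∧ f₁.card = 3 ∧ f₂.card = 3 ∧
    (f₁ ∩ f₂).card = 1 ∧ v ∉ f₁ ∪ f₂ ∧
    H = {f₁, f₂} ∪
      (V.powersetCard 3).filter (fun t => v ∈ t ∧ (t ∩ (f₁ ∪ f₂)).Nonempty)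

/-- `H` is (isomorphic to) a sub-3-graph of `SPₙ` on `V`. -/
def SubSP (V : Finset ℕ) (H : Finset (Finset ℕ)) : Prop :=
  ∃ H' : Finset (Finset ℕ), IsSPOn V H' ∧ H ⊆ H'

/-- `H` is the compact balloon `CBₙ` on `V`: a full star on `V \ {z₁, z₂}`
with center `x`, together with the seven extra edges `{y₁,y₂,z₁}`,
`{y₁,y₂,z₂}`, `{x,yᵢ,zⱼ}` for `i,j ∈ {1,2}`, and `{x,z₁,z₂}`. -/
def IsCBOn (V : Finset ℕ) (H : Finset (Finset ℕ)) : Prop :=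
  ∃ x y₁ y₂ z₁ z₂ : ℕ, ({x, y₁, y₂, z₁, z₂} : Finset ℕ) ⊆ V ∧
    ({x, y₁, y₂, z₁, z₂} : Finset ℕ).card = 5 ∧
    H = ((V \ {z₁, z₂}).powersetCard 3).filter (fun t => x ∈ t) ∪
      ({{y₁, y₂, z₁}, {y₁, y₂, z₂}, {x, y₁, z₁}, {x, y₁, z₂},
        {x, y₂, z₁}, {x, y₂, z₂}, {x, z₁, z₂}} : Finset (Finset ℕ))

/-- `H` is (isomorphic to) a sub-3-graph of `CBₙ` on `V`. -/
def SubCB (V : Finset ℕ) (H : Finset (Finset ℕ)) : Prop :=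
  ∃ H' : Finset (Finset ℕ), IsCBOn V H' ∧ H ⊆ H'


def dz (a b : ℕ) : Bool := Nat.beq (Nat.land a b) 0

def viol (L : List ℕ) : Bool :=
  L.any fun a => L.any fun b => dz a b && L.any fun c => L.any fun d => dz c d &&
    ((dz b c && !dz a d) ||
      (Nat.beq (Nat.lor a b) (Nat.lor c d) && (!(Nat.beq a c) && !(Nat.beq a d))))

structure GoodP (P : ℕ → Prop) : Prop where
  m1 : ∀ a b c d, P a → P b → P c → P d → a &&& b = 0 → b &&& c = 0 → c &&& d = 0 → a &&& d = 0
  m3 : ∀ a b c d, P a → P b → P c → P d → a &&& b = 0 → c &&& d = 0 → a ||| b = c ||| d →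
    a = c ∨ a = d

theorem dz_iff {a b : ℕ} : dz a b = true ↔ a &&& b = 0 := by
  unfold dz; rw [Nat.beq_eq]; rfl

theorem GoodP.viol {P : ℕ → Prop} (h : GoodP P) {L : List ℕ} (hL : ∀ x ∈ L, P x) :
    viol L = false := by
  by_contra hc
  rw [Bool.not_eq_false] at hc
  simp only [_root_.viol, List.any_eq_true, Bool.and_eq_true, Bool.or_eq_true,
    Bool.not_eq_true', ← Bool.not_eq_true, dz_iff, Nat.beq_eq] at hc
  obtain ⟨a, ha, b, hb, hab, c, hc, d, hd, hcd, h1 | h1⟩ := hc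
  · exact h1.2 (h.m1 a b c d (hL _ ha) (hL _ hb) (hL _ hc) (hL _ hd) hab h1.1 hcd)
  · rcases h.m3 a b c d (hL _ ha) (hL _ hb) (hL _ hc) (hL _ hd) hab hcd h1.1 with h2 | h2
    · exact h1.2.1 h2
    · exact h1.2.2 h2

/-- entry: code, index, row of compatible indices -/
abbrev Ent := ℕ × ℕ × ℕ

def ecmp (e f : Ent) : Bool := Nat.beq (Nat.land 1 (Nat.shiftRight e.2.2 f.2.1)) 1

def cnt (m : ℕ) : List Ent → ℕ
  | [] => 0
  | e :: t => bif dz e.1 m then cnt m t else Nat.succ (cnt m t)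

def go (m1 m2 b1 b2 : ℕ) : ℕ → List Ent → ℕ → ℕ → List ℕ → List ℕ → Bool
  | 0, _, _, _, _, _ => false
  | k + 1, rem, c1, c2, al, ch =>
    Nat.ble (Nat.add c1 (cnt m1 rem)) b1 || (Nat.ble (Nat.add c2 (cnt m2 rem)) b2 ||
     ((al.any fun v => rem.all fun x => !dz x.1 v) ||
      match rem with
      | [] => viol ch
      | e :: t => go m1 m2 b1 b2 k t c1 c2 al ch &&
         go m1 m2 b1 b2 k (t.filter (ecmp e)) (bif dz e.1 m1 then c1 else Nat.succ c1)
          (bif dz e.1 m2 then c2 else Nat.succ c2) (al.filter fun v => !dz e.1 v) (e.1 :: ch)))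

def sel (P : ℕ → Prop) [DecidablePred P] (L : List Ent) : List Ent := L.filter fun e => decide (P e.1)

theorem cnt_le (m : ℕ) {L M : List Ent} (h : List.Sublist L M) : cnt m L ≤ cnt m M := by
  induction h with
  | slnil => simp
  | cons a _ ih => 
    simp only [cnt]; cases dz a.1 m <;> simp <;> omega
  | cons_cons a _ ih => 
    simp only [cnt]; cases dz a.1 m <;> simp <;> omega

theorem go_sound {P : ℕ → Prop} [DecidablePred P] (hP : GoodP P)
    (T : List Ent) (hT : ∀ e ∈ T, ∀ f ∈ T, ecmp e f = false → ¬ (P e.1 ∧ P f.1))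
    (m1 m2 b1 b2 : ℕ) : ∀ (k : ℕ) (rem : List Ent) (c1 c2 : ℕ) (al ch : List ℕ),
      (∀ e ∈ rem, e ∈ T) → (∀ x ∈ ch, P x) → go m1 m2 b1 b2 k rem c1 c2 al ch = true →
      c1 + cnt m1 (sel P rem) ≤ b1 ∨ c2 + cnt m2 (sel P rem) ≤ b2 ∨
        ∃ v ∈ al, ∀ e ∈ rem, P e.1 → e.1 &&& v ≠ 0 := by
  intro k
  induction k with
  | zero => intro rem c1 c2 al ch _ _ h; simp [go] at h
  | succ k ih =>
    intro rem c1 c2 al ch hr hch h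
    have hs : List.Sublist (sel P rem) rem := List.filter_sublist
    have hs1 := cnt_le m1 hs
    have hs2 := cnt_le m2 hs
    simp only [go, Bool.or_eq_true, Nat.ble_eq, Nat.add_eq] at h
    rcases h with h | h | h | h
    · left; omega
    · right; left; omega
    · right; right
      simp only [List.any_eq_true, List.all_eq_true, Bool.not_eq_true', ← Bool.not_eq_true, dz_iff] at h
      obtain ⟨v, hv, h⟩ := h
      exact ⟨v, hv, fun e he _ => h e he⟩
    · match rem, h with
      | [], h => rw [hP.viol hch] at h; simp at h
      | e :: t, h =>
        simp only [Bool.and_eq_true] at h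
        by_cases he : P e.1
        · have hsel : sel P (e :: t) = e :: sel P (t.filter (ecmp e)) := by
            unfold sel
            rw [List.filter_cons_of_pos (by simpa using he), List.filter_filter]
            congr 1
            apply List.filter_congr
            intro x hx
            by_cases hx' : P x.1
            · have : ecmp e x = true := by
                by_contra hc
                exact hT e (hr e (by simp)) x (hr x (by simp [hx])) (by simpa using hc) ⟨he, hx'⟩
              simp [this]
            · simp [hx']
          have := ih (t.filter (ecmp e)) _ _ _ _ (fun x hx => hr x (by
              simp only [List.mem_filter] at hx; simp [hx.1])) (by
              intro x hx; rcases List.mem_cons.1 hx with rfl | hx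
              · exact he
              · exact hch x hx) h.2
          rw [hsel]
          simp only [cnt]
          rcases this with h | h | ⟨v, hv, h⟩
          · left; cases hh : dz e.1 m1 <;> simp [hh] at h ⊢ <;> omega
          · right; left; cases hh : dz e.1 m2 <;> simp [hh] at h ⊢ <;> omega
          · right; right
            simp only [List.mem_filter, Bool.not_eq_true', ← Bool.not_eq_true, dz_iff] at hv
            refine ⟨v, hv.1, ?_⟩
            intro x hx hpx
            rcases List.mem_cons.1 hx with rfl | hx
            · exact hv.2
            · apply h x _ hpx
              simp only [List.mem_filter, hx, true_and]
              by_contra hc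
              exact hT e (hr e (by simp)) x (hr x (by simp [hx])) (by simpa using hc) ⟨he, hpx⟩
        · have hsel : sel P (e :: t) = sel P t := by
            unfold sel
            rw [List.filter_cons_of_neg (by simpa using he)]
          rw [hsel]
          rcases ih t c1 c2 al ch (fun x hx => hr x (by simp [hx])) hch h.1 with h | h | ⟨v, hv, h⟩
          · exact Or.inl h
          · exact Or.inr (Or.inl h)
          · refine Or.inr (Or.inr ⟨v, hv, ?_⟩)
            intro x hx hpx
            rcases List.mem_cons.1 hx with rfl | hx
            · exact absurd hpx he
            · exact h x hx hpx


def coreA : List ℕ := [19, 44, 69, 138]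
def coreB : List ℕ := [19, 44, 21, 74]

def tabA0 : List Ent := [(49, 0, 275957989858389), (50, 1, 270444419984554), (52, 2, 270462042660117),
  (56, 3, 275942783757866), (112, 4, 268242349416405), (176, 5, 278155228917738),
  (193, 6, 281124793570545), (194, 7, 280782269949170), (196, 8, 280778636942132),
  (200, 9, 281122502781752), (208, 10, 280637583209727), (224, 11, 281260478614335),
  (21, 12, 246273382241621), (26, 13, 140702992148138), (37, 14, 263865542334805),
  (42, 15, 211071851735722), (67, 16, 211101894931667), (76, 17, 140728829926172),
  (131, 18, 263878358709475), (140, 19, 246281993382700), (82, 20, 131356197500159),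
  (84, 21, 131382478888917), (97, 22, 206632956428245), (104, 23, 206604837251903),
  (145, 24, 244896752956671), (152, 25, 244907354550250), (162, 26, 261540955406314),
  (164, 27, 261528594668351), (7, 28, 281474934763975), (11, 29, 281474840392395),
  (13, 30, 281474908549965), (14, 31, 281474955735950), (28, 32, 281466315142975),
  (35, 33, 281470645434623), (74, 34, 281440465956826), (133, 35, 281457787363301),
  (22, 36, 280925208311231), (25, 37, 281199897474687), (38, 38, 281337487423935),
  (41, 39, 281406254086783), (70, 40, 272678833356758), (73, 41, 277076728872921),
  (134, 42, 279275940872166), (137, 43, 280375461937129), (88, 44, 281474775105535),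
  (98, 45, 281474925850623), (148, 46, 281474964029439), (161, 47, 281474973425663)]

def tabA1 : List Ent := [(112, 0, 1151800523500770141), (176, 1, 3745872013264137390),
  (208, 2, 4394397057481438519), (224, 3, 4556519047839939275),
  (276, 4, 1573862511425642325), (280, 5, 3087144236834402214),
  (289, 6, 3146322528456236889), (290, 7, 1687439652542394282),
  (322, 8, 2111897322230326773), (328, 9, 3355109515311483641),
  (385, 10, 4229433823644030454), (388, 11, 3851561325807028986),
  (49, 12, 3169944496596145245), (50, 13, 1729056249122824622),
  (52, 14, 1729204933788719197), (56, 15, 3170444525972267694),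
  (193, 16, 4521028979885544775), (194, 17, 4431223069157303687),
  (196, 18, 4431361570523335195), (200, 19, 4521523723029482027),
  (21, 20, 4609433932450323669), (26, 21, 4602678234883728358),
  (37, 22, 4610559825310735481), (42, 23, 4607181864458429370),
  (67, 24, 4607182338763472325), (76, 25, 4602678663393889849),
  (82, 26, 2152401213179820471), (84, 27, 2152543453406256029),
  (97, 28, 3435657089395939181), (104, 29, 3436155805889263339),
  (131, 30, 4610560013121042374), (140, 31, 4609434075519568698),
  (145, 32, 4248560996843779703), (152, 33, 4249057050391195246),
  (162, 34, 3997745044730654110), (164, 35, 3997889969042291163),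
  (28, 36, 4611684762937784887), (35, 37, 4611677142708909515),
  (74, 38, 4611683230988346285), (133, 39, 4611681344888462430),
  (259, 40, 4606047645356471800), (261, 41, 4608303645177806674),
  (266, 42, 4598172432111173537), (268, 43, 4600425764960062196),
  (262, 44, 4611686004736552944), (265, 45, 4611685966686035952),
  (7, 46, 4611686009300024784), (11, 47, 4611685983933151200), (13, 48, 4611686001180270192),
  (14, 49, 4611686013863914416), (88, 50, 4611682667274957631),
  (98, 51, 4611675008277672911), (148, 52, 4611680520038775871),
  (161, 53, 4611672824050875599), (22, 54, 4467570829545634231),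
  (25, 55, 4539628372849456759), (38, 56, 4575657208522930651),
  (41, 57, 4593671619716183787), (70, 58, 2305842996328754077),
  (73, 59, 3458764462280906605), (134, 60, 4035225265318620574),
  (137, 61, 4323455642074324590)]

def tabB1 : List Ent := [(162, 0, 8782353888063), (196, 1, 8792622927103), (98, 2, 5497517765399),
  (100, 3, 5497514872043), (138, 4, 7958565846807), (140, 5, 7968233798891),
  (161, 6, 8615147593706), (176, 7, 8636893229034), (193, 8, 8690712180693),
  (208, 9, 8709035260885), (37, 10, 6596531768826), (52, 11, 7696312667898),
  (67, 12, 6596933317493), (82, 13, 7696513725365), (131, 14, 8237074085853),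
  (133, 15, 8243517579246), (146, 16, 8516584078301), (148, 17, 8519805562862),
  (11, 18, 8787502953845), (13, 19, 8793945464186), (26, 20, 8791798020789),
  (28, 21, 8795019259578), (49, 22, 4260590780376), (81, 23, 4329310257124),
  (14, 24, 8796080438335), (25, 25, 8589934591984), (41, 26, 8761733078525),
  (56, 27, 8778913099517), (73, 28, 8761733085054), (88, 29, 8778913102782),
  (35, 30, 8796090793437), (50, 31, 8796092464861), (69, 32, 8796091907950),
  (84, 33, 8796092743598), (7, 34, 8795421932927), (22, 35, 8795757477567),
  (38, 36, 8796051078399), (70, 37, 8796055273279), (97, 38, 8796092825551),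
  (112, 39, 8796092973007), (137, 40, 8796093011955), (152, 41, 8796093017075),
  (134, 42, 8796080439295)]

def tabA2 : List Ent := [(276, 0, 132876789), (280, 1, 200091386), (289, 2, 192628469), (290, 3, 125639162),
  (322, 4, 131569759), (328, 5, 199123631), (385, 6, 196568159), (388, 7, 129929647),
  (532, 8, 230618505), (536, 9, 249494054), (545, 10, 246936902), (546, 11, 232258073),
  (578, 12, 226320280), (584, 13, 250457954), (641, 14, 242966372), (644, 15, 233549713),
  (259, 16, 267910239), (261, 17, 268161013), (266, 18, 268255226), (268, 19, 268366767),
  (515, 20, 260005884), (517, 21, 264238543), (522, 22, 266336831), (524, 23, 267366387),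
  (262, 24, 268409343), (265, 25, 268396287), (518, 26, 268435353), (521, 27, 268435302)]

def tabB2 : List Ent := [(162, 0, 921530567), (196, 1, 922136635), (290, 2, 995875853), (324, 3, 1033626382),
  (161, 4, 301950962), (176, 5, 507472882), (193, 6, 301964785), (208, 7, 507485937),
  (289, 8, 801611640), (304, 9, 804822968), (321, 10, 801599444), (336, 11, 804810724),
  (138, 12, 1072550855), (140, 13, 1073146939), (266, 14, 998210621), (268, 15, 1035973582),
  (131, 16, 872404477), (133, 17, 905963006), (137, 18, 973075955), (146, 19, 1048566525),
  (148, 20, 1052764926), (152, 21, 1061157619), (259, 22, 1070563159), (261, 23, 1071103835),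
  (265, 24, 1072168796), (274, 25, 1073315751), (276, 26, 1073397675), (280, 27, 1073545132),
  (134, 28, 1073737983), (262, 29, 1073741583)]

def memN (x : ℕ) (L : List ℕ) : Bool := L.any fun y => Nat.beq x y

def tabOK (core : List ℕ) (T : List Ent) : Bool :=
  T.all fun e => T.all fun f => ecmp e f || viol (e.1 :: f.1 :: core)

def allT (m : ℕ) (p : ℕ → Bool) : Bool :=
  (List.range m).all fun i => (List.range i).all fun j => (List.range j).all fun k =>
    p (2 ^ i ||| (2 ^ j ||| 2 ^ k))

def covOK (core : List ℕ) (T : List Ent) (q : ℕ → Bool) (m : ℕ) : Bool :=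
  allT m fun t => !q t || (memN t core || (memN t (T.map Prod.fst) || viol (t :: core)))

set_option maxRecDepth 100000
theorem okA0 : tabOK coreA tabA0 = true := by decide +kernel
theorem okA1 : tabOK coreA tabA1 = true := by decide +kernel
theorem okA2 : tabOK coreA tabA2 = true := by decide +kernel
theorem okB1 : tabOK coreB tabB1 = true := by decide +kernel
theorem okB2 : tabOK coreB tabB2 = true := by decide +kernel

theorem goA0 : go 1023 1023 17 17 200 tabA0 0 0 [1, 2, 4, 8] coreA = true := by decide +kernel
theorem goA1 : go 1023 1023 21 21 200 tabA1 0 0 [1, 2, 4, 8] coreA = true := by decide +kernel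
theorem goB1 : go 1023 1023 17 17 200 tabB1 0 0 [1, 16, 4, 2] coreB = true := by decide +kernel
theorem goA2 : go 256 512 4 4 200 tabA2 0 0 [1, 2, 4, 8] coreA = true := by decide +kernel
theorem goB2 : go 128 256 4 4 200 tabB2 0 0 [1, 16, 4, 2] coreB = true := by decide +kernel

theorem covA0 : covOK coreA tabA0 (fun _ => true) 8 = true := by decide +kernel
theorem covA1 : covOK coreA tabA1 (fun _ => true) 9 = true := by decide +kernel
theorem covB1 : covOK coreB tabB1 (fun _ => true) 8 = true := by decide +kernel
def q2 (cs t : ℕ) : Bool := xor (dz t (2 ^ cs)) (dz t (2 ^ (cs + 1)))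
theorem covA2 : covOK coreA tabA2 (q2 8) 10 = true := by decide +kernel
theorem covB2 : covOK coreB tabB2 (q2 7) 9 = true := by decide +kernel

/-- codes in the table containing both `v` and `w`. -/
def five (T : List Ent) (v w : ℕ) : List ℕ :=
  (T.map Prod.fst).filter fun t => !dz t v && !dz t w

def f3OK (core : List ℕ) (T : List Ent) (cs m : ℕ) (vs : List ℕ) : Bool :=
  vs.all fun v => Nat.beq (five T v (2 ^ cs)).length 5 &&
    allT m fun t => !dz t v || (!dz t (2 ^ cs) || (memN t core ||
      viol (t :: (core ++ five T v (2 ^ cs)))))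
theorem f3A : f3OK coreA tabA1 8 10 [1, 2, 4, 8] = true := by decide +kernel
theorem f3B : f3OK coreB tabB1 7 9 [1, 16, 4, 2] = true := by decide +kernel


def D1 (H : Finset (Finset ℕ)) : Prop := ∀ a ∈ H, ∀ b ∈ H, ∀ c ∈ H, ∀ d ∈ H,
  a ∩ b = ∅ → b ∩ c = ∅ → c ∩ d = ∅ → a ∩ d = ∅
def D3 (H : Finset (Finset ℕ)) : Prop := ∀ a ∈ H, ∀ b ∈ H, ∀ c ∈ H, ∀ d ∈ H,
  a ∩ b = ∅ → c ∩ d = ∅ → a ∪ b = c ∪ d → a = c ∨ a = d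

def img (v : ℕ → ℕ) (m c : ℕ) : Finset ℕ := ((range m).filter (fun i => c.testBit i = true)).image v

theorem mem_img {v : ℕ → ℕ} {m c x : ℕ} : x ∈ img v m c ↔ ∃ i < m, c.testBit i = true ∧ v i = x := by
  simp [img, and_assoc]

def InjR (v : ℕ → ℕ) (m : ℕ) : Prop := ∀ i < m, ∀ j < m, v i = v j → i = j

theorem img_mem_iff {v : ℕ → ℕ} {m c i : ℕ} (hv : InjR v m) (hi : i < m) :
    v i ∈ img v m c ↔ c.testBit i = true := by
  rw [mem_img]
  constructor
  · rintro ⟨j, hj, h, e⟩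
    rw [← hv j hj i hi e]; exact h
  · intro h; exact ⟨i, hi, h, rfl⟩

theorem img_inter {v : ℕ → ℕ} {m : ℕ} (hv : InjR v m) (a b : ℕ) :
    img v m a ∩ img v m b = img v m (a &&& b) := by
  ext x
  rw [mem_inter]
  constructor
  · rintro ⟨h1, h2⟩
    obtain ⟨i, hi, h, rfl⟩ := mem_img.1 h1
    rw [img_mem_iff hv hi] at h2 ⊢
    simp [h, h2]
  · intro h1
    obtain ⟨i, hi, h, rfl⟩ := mem_img.1 h1
    simp only [img_mem_iff hv hi]
    simpa using h

theorem img_union {v : ℕ → ℕ} {m : ℕ} (hv : InjR v m) (a b : ℕ) :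
    img v m a ∪ img v m b = img v m (a ||| b) := by
  ext x
  rw [mem_union]
  constructor
  · rintro (h1 | h1) <;>
    · obtain ⟨i, hi, h, rfl⟩ := mem_img.1 h1
      rw [img_mem_iff hv hi]
      simp [h]
  · intro h1
    obtain ⟨i, hi, h, rfl⟩ := mem_img.1 h1
    simp only [img_mem_iff hv hi]
    simpa using h

theorem img_inj {v : ℕ → ℕ} {m a b : ℕ} (hv : InjR v m) (ha : a < 2 ^ m) (hb : b < 2 ^ m)
    (h : img v m a = img v m b) : a = b := by
  apply Nat.eq_of_testBit_eq
  intro i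
  by_cases hi : i < m
  · rw [Bool.eq_iff_iff, ← img_mem_iff hv hi, ← img_mem_iff hv hi, h]
  · have : 2 ^ m ≤ 2 ^ i := Nat.pow_le_pow_right (by norm_num) (by omega)
    rw [Nat.testBit_lt_two_pow (by omega), Nat.testBit_lt_two_pow (by omega)]

theorem img_zero {v : ℕ → ℕ} {m : ℕ} : img v m 0 = ∅ := by simp [img]

theorem img_inter_empty {v : ℕ → ℕ} {m a b : ℕ} (hv : InjR v m) (ha : a < 2 ^ m) :
    img v m a ∩ img v m b = ∅ ↔ a &&& b = 0 := by
  rw [img_inter hv]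
  constructor
  · intro h
    exact img_inj hv (lt_of_le_of_lt Nat.and_le_left ha) (by positivity) (h.trans img_zero.symm)
  · intro h; rw [h, img_zero]

def PP (H : Finset (Finset ℕ)) (v : ℕ → ℕ) (m c : ℕ) : Prop := c < 2 ^ m ∧ img v m c ∈ H

instance (H : Finset (Finset ℕ)) (v : ℕ → ℕ) (m : ℕ) : DecidablePred (PP H v m) := fun c => by
  unfold PP; infer_instance

theorem PP_good {H : Finset (Finset ℕ)} {v : ℕ → ℕ} {m : ℕ} (hv : InjR v m) (h1 : D1 H) (h3 : D3 H) :
    GoodP (PP H v m) := by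
  constructor
  · intro a b c d ha hb hc hd
    rw [← img_inter_empty hv ha.1, ← img_inter_empty hv hb.1, ← img_inter_empty hv hc.1,
      ← img_inter_empty hv ha.1]
    exact h1 _ ha.2 _ hb.2 _ hc.2 _ hd.2
  · intro a b c d ha hb hc hd hab hcd he
    rw [← img_inter_empty hv ha.1] at hab
    rw [← img_inter_empty hv hc.1] at hcd
    have := h3 _ ha.2 _ hb.2 _ hc.2 _ hd.2 hab hcd (by rw [img_union hv, img_union hv, he])
    rcases this with h | h
    · exact Or.inl (img_inj hv ha.1 hc.1 h)
    · exact Or.inr (img_inj hv ha.1 hd.1 h)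

theorem tri_code {v : ℕ → ℕ} {m : ℕ} (hv : InjR v m) {e : Finset ℕ} (he : e.card = 3)
    (hs : e ⊆ (range m).image v) : ∃ i < m, ∃ j < i, ∃ k < j,
      (2 ^ i ||| (2 ^ j ||| 2 ^ k)) < 2 ^ m ∧ img v m (2 ^ i ||| (2 ^ j ||| 2 ^ k)) = e := by
  have key : ∀ i < m, ∀ j < i, ∀ k < j, e = {v i, v j, v k} → ∃ i < m, ∃ j < i, ∃ k < j,
      (2 ^ i ||| (2 ^ j ||| 2 ^ k)) < 2 ^ m ∧ img v m (2 ^ i ||| (2 ^ j ||| 2 ^ k)) = e := by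
    intro i hi j hj k hk h
    refine ⟨i, hi, j, hj, k, hk, ?_, ?_⟩
    · have : ∀ t < m, 2 ^ t < 2 ^ m := fun t ht => Nat.pow_lt_pow_right (by norm_num) ht
      exact Nat.or_lt_two_pow (this i hi) (Nat.or_lt_two_pow (this j (by omega)) (this k (by omega)))
    · rw [h]; ext x; rw [mem_img]
      simp only [Nat.testBit_or, Nat.testBit_two_pow, Bool.or_eq_true, decide_eq_true_eq, mem_insert,
        mem_singleton]
      constructor
      · rintro ⟨t, ht, rfl | rfl | rfl, rfl⟩ <;> simp
      · rintro (rfl | rfl | rfl)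
        · exact ⟨i, hi, by simp⟩
        · exact ⟨j, by omega, by simp⟩
        · exact ⟨k, by omega, by simp⟩
  obtain ⟨x, y, z, hxy, hxz, hyz, rfl⟩ := card_eq_three.1 he
  obtain ⟨i, hi, rfl⟩ := mem_image.1 (hs (by simp : x ∈ _))
  obtain ⟨j, hj, rfl⟩ := mem_image.1 (hs (by simp : y ∈ _))
  obtain ⟨k, hk, rfl⟩ := mem_image.1 (hs (by simp : z ∈ _))
  rw [mem_range] at hi hj hk
  have h1 : i ≠ j := fun h => hxy (by rw [h])
  have h2 : i ≠ k := fun h => hxz (by rw [h])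
  have h3 : j ≠ k := fun h => hyz (by rw [h])
  rcases lt_or_gt_of_ne h1 with a | a <;> rcases lt_or_gt_of_ne h2 with b | b <;>
    rcases lt_or_gt_of_ne h3 with c | c
  · exact key k hk j c i a (by ext; simp; tauto)
  · exact key j hj k c i b (by ext; simp; tauto)
  · omega
  · exact key j hj i a k b (by ext; simp; tauto)
  · exact key k hk i b j a (by ext; simp; tauto)
  · omega
  · exact key i hi k b j c (by ext; simp; tauto)
  · exact key i hi j a k c (by ext; simp)

theorem allT_spec {m : ℕ} {p : ℕ → Bool} (h : allT m p = true) {i j k : ℕ} (hi : i < m) (hj : j < i)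
    (hk : k < j) : p (2 ^ i ||| (2 ^ j ||| 2 ^ k)) = true := by
  simp only [allT, List.all_eq_true, List.mem_range] at h
  exact h i hi j hj k hk

theorem memN_iff {x : ℕ} {L : List ℕ} : memN x L = true ↔ x ∈ L := by
  simp [memN, List.any_eq_true]

theorem cnt_eq (m : ℕ) (L : List Ent) : cnt m L = (L.filter fun e => !dz e.1 m).length := by
  induction L with
  | nil => rfl
  | cons a t ih =>
    simp only [cnt]
    cases h : dz a.1 m <;> simp [h, ih]

theorem cnt_bound {H F : Finset (Finset ℕ)} {v : ℕ → ℕ} {m M : ℕ} {T : List Ent}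
    (h : ∀ e ∈ F, ∃ t, PP H v m t ∧ t ∈ T.map Prod.fst ∧ t &&& M ≠ 0 ∧ img v m t = e) :
    F.card ≤ cnt M (sel (PP H v m) T) := by
  rw [cnt_eq]
  set L := ((sel (PP H v m) T).filter fun e => !dz e.1 M).map (fun e => img v m e.1) with hL
  have : F ⊆ L.toFinset := by
    intro e he
    obtain ⟨t, h1, h2, h3, h4⟩ := h e he
    obtain ⟨x, hx, rfl⟩ := List.mem_map.1 h2
    rw [List.mem_toFinset, hL, List.mem_map]
    refine ⟨x, ?_, h4⟩
    simp only [sel, List.mem_filter, hx, decide_eq_true_eq, h1, true_and, Bool.not_eq_true',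
      ← Bool.not_eq_true, dz_iff]
    exact h3
  calc F.card ≤ L.toFinset.card := card_le_card this
    _ ≤ L.length := List.toFinset_card_le L
    _ = _ := by rw [hL, List.length_map]

theorem model_search {H : Finset (Finset ℕ)} {v : ℕ → ℕ} {m : ℕ} (hv : InjR v m) (h1 : D1 H) (h3 : D3 H)
    (hu : ∀ e ∈ H, e.card = 3) {core : List ℕ} {T : List Ent} {q : ℕ → Bool} {m1 m2 b1 b2 k : ℕ}
    {vs : List ℕ} (htab : tabOK core T = true) (hcov : covOK core T q m = true)
    (hgo : go m1 m2 b1 b2 k T 0 0 vs core = true)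
    (hcore : ∀ c ∈ core, PP H v m c) (G F1 F2 : Finset (Finset ℕ)) (hG : G ⊆ H)
    (hGs : ∀ e ∈ G, e ⊆ (range m).image v) (hGc : ∀ e ∈ G, ∀ c ∈ core, img v m c ≠ e)
    (hq : ∀ t < 2 ^ m, img v m t ∈ G → q t = true)
    (hF1 : F1 ⊆ G) (hF2 : F2 ⊆ G) (hF1' : ∀ e ∈ F1, e ∩ img v m m1 ≠ ∅)
    (hF2' : ∀ e ∈ F2, e ∩ img v m m2 ≠ ∅) :
    F1.card ≤ b1 ∨ F2.card ≤ b2 ∨ ∃ x ∈ vs, ∀ e ∈ G, e ∩ img v m x ≠ ∅ := by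
  have hP := PP_good hv h1 h3
  have hT : ∀ e ∈ T, ∀ f ∈ T, ecmp e f = false → ¬ (PP H v m e.1 ∧ PP H v m f.1) := by
    rintro e he f hf hef ⟨pe, pf⟩
    simp only [tabOK, List.all_eq_true] at htab
    have := htab e he f hf
    rw [hef, Bool.false_or, hP.viol] at this
    · simp at this
    · intro x hx
      simp only [List.mem_cons] at hx
      rcases hx with rfl | rfl | hx
      · exact pe
      · exact pf
      · exact hcore x hx
  have code : ∀ e ∈ G, ∃ t, PP H v m t ∧ t ∈ T.map Prod.fst ∧ img v m t = e := by
    intro e he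
    obtain ⟨i, hi, j, hj, k, hk, hlt, hE⟩ := tri_code hv (hu e (hG he)) (hGs e he)
    refine ⟨_, ⟨hlt, by rw [hE]; exact hG he⟩, ?_, hE⟩
    have := allT_spec hcov hi hj hk
    have pt : PP H v m (2 ^ i ||| (2 ^ j ||| 2 ^ k)) := ⟨hlt, by rw [hE]; exact hG he⟩
    rw [hP.viol (L := _ :: core), hq _ hlt (by rw [hE]; exact he)] at this
    · simp only [Bool.not_true, Bool.false_or, Bool.or_false, Bool.or_eq_true, memN_iff] at this
      rcases this with h | h
      · exact absurd hE (hGc e he _ h)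
      · exact h
    · intro x hx
      rcases List.mem_cons.1 hx with rfl | hx
      · exact pt
      · exact hcore x hx
  have := go_sound hP T hT m1 m2 b1 b2 k T 0 0 vs core (fun _ h => h) hcore hgo
  simp only [zero_add] at this
  rcases this with h | h | ⟨x, hx, h⟩
  · left
    refine le_trans (cnt_bound (v := v) (m := m) (H := H) ?_) h
    intro e he
    obtain ⟨t, p, ht, hE⟩ := code e (hF1 he)
    refine ⟨t, p, ht, ?_, hE⟩
    have := hF1' e he
    rwa [← hE, Ne, img_inter_empty hv p.1] at this
  · right; left
    refine le_trans (cnt_bound (v := v) (m := m) (H := H) ?_) h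
    intro e he
    obtain ⟨t, p, ht, hE⟩ := code e (hF2 he)
    refine ⟨t, p, ht, ?_, hE⟩
    have := hF2' e he
    rwa [← hE, Ne, img_inter_empty hv p.1] at this
  · right; right
    refine ⟨x, hx, ?_⟩
    intro e he
    obtain ⟨t, p, ht, hE⟩ := code e he
    obtain ⟨y, hy, rfl⟩ := List.mem_map.1 ht
    rw [← hE, Ne, img_inter_empty hv p.1]
    exact h y hy p

theorem img_ext {v : ℕ → ℕ} {m m' t : ℕ} (h : m' ≤ m) (ht : t < 2 ^ m') : img v m' t = img v m t := by
  ext x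
  rw [mem_img, mem_img]
  constructor
  · rintro ⟨i, hi, h1⟩; exact ⟨i, by omega, h1⟩
  · rintro ⟨i, hi, h1, h2⟩
    refine ⟨i, ?_, h1, h2⟩
    by_contra hc
    rw [Nat.testBit_lt_two_pow] at h1
    · simp at h1
    · exact lt_of_lt_of_le ht (Nat.pow_le_pow_right (by norm_num) (by omega))

theorem img_two_pow {v : ℕ → ℕ} {m i : ℕ} (hi : i < m) : img v m (2 ^ i) = {v i} := by
  ext x
  rw [mem_img]
  simp only [Nat.testBit_two_pow, decide_eq_true_eq, mem_singleton]
  constructor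
  · rintro ⟨j, _, rfl, rfl⟩; rfl
  · rintro rfl; exact ⟨i, hi, rfl, rfl⟩

theorem inter_ne_empty_singleton {e : Finset ℕ} {x : ℕ} : e ∩ {x} ≠ ∅ ↔ x ∈ e := by
  rw [← nonempty_iff_ne_empty]
  constructor
  · rintro ⟨y, hy⟩
    rw [mem_inter, mem_singleton] at hy
    rw [← hy.2]; exact hy.1
  · intro h; exact ⟨x, by simp [h]⟩

theorem model_f3 {H : Finset (Finset ℕ)} {v : ℕ → ℕ} {cs m : ℕ} (hv : InjR v m) (h1 : D1 H) (h3 : D3 H)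
    (hu : ∀ e ∈ H, e.card = 3) {core : List ℕ} {T : List Ent} (hm : cs + 1 ≤ m)
    {vs : List ℕ} (hcov : covOK core T (fun _ => true) (cs + 1) = true)
    {m0 : ℕ} (hm0 : m ≤ m0) (hf : f3OK core T cs m0 vs = true)
    (hcore : ∀ c ∈ core, PP H v m c) (x : ℕ) (hx : x ∈ vs) (F : Finset (Finset ℕ)) (hF : F ⊆ H)
    (hFs : ∀ e ∈ F, e ⊆ (range (cs + 1)).image v) (hFc : ∀ e ∈ F, ∀ c ∈ core, img v m c ≠ e)
    (hFw : ∀ e ∈ F, v cs ∈ e) (hFx : ∀ e ∈ F, e ∩ img v m x ≠ ∅) (hF5 : 5 ≤ F.card)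
    (e : Finset ℕ) (he : e ∈ H) (hes : e ⊆ (range m).image v) (hew : v cs ∉ e)
    (hec : ∀ c ∈ core, img v m c ≠ e) : e ∩ img v m x ≠ ∅ := by
  have hP := PP_good hv h1 h3
  have hv' : InjR v (cs + 1) := fun i hi j hj h => hv i (by omega) j (by omega) h
  simp only [f3OK, List.all_eq_true, Bool.and_eq_true, Nat.beq_eq] at hf
  obtain ⟨hlen, hall⟩ := hf x hx
  set L := five T x (2 ^ cs) with hL
  have hfive : ∀ t ∈ L, PP H v m t := by
    have hsub : F ⊆ ((L.filter fun t => decide (PP H v m t)).map (img v m)).toFinset := by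
      intro f hf
      obtain ⟨i, hi, j, hj, k, hk, hlt, hE⟩ := tri_code hv' (hu f (hF hf)) (hFs f hf)
      have hlt' := lt_of_lt_of_le hlt (Nat.pow_le_pow_right (by norm_num) hm)
      rw [img_ext hm hlt] at hE
      have pt : PP H v m (2 ^ i ||| (2 ^ j ||| 2 ^ k)) := ⟨hlt', by rw [hE]; exact hF hf⟩
      have := allT_spec hcov hi hj hk
      rw [hP.viol (L := _ :: core)] at this
      · simp only [Bool.not_true, Bool.false_or, Bool.or_false, Bool.or_eq_true, memN_iff] at this
        rw [List.mem_toFinset, List.mem_map]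
        refine ⟨_, ?_, hE⟩
        rcases this with h | h
        · exact absurd hE (hFc f hf _ h)
        · rw [List.mem_filter]
          refine ⟨?_, by simpa using pt⟩
          rw [hL, five, List.mem_filter]
          refine ⟨h, ?_⟩
          simp only [Bool.and_eq_true, Bool.not_eq_true', ← Bool.not_eq_true, dz_iff]
          rw [← img_inter_empty hv hlt', ← img_inter_empty hv hlt', hE, img_two_pow (by omega)]
          exact ⟨hFx f hf, inter_ne_empty_singleton.2 (hFw f hf)⟩
      · intro x hx
        rcases List.mem_cons.1 hx with rfl | hx
        · exact pt
        · exact hcore x hx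
    have h5 := (card_le_card hsub).trans (List.toFinset_card_le _)
    rw [List.length_map] at h5
    have h6 : (L.filter fun t => decide (PP H v m t)).length ≤ L.length := List.length_filter_le _ _
    have h7 := (List.length_filter_eq_length_iff (l := L) (p := fun t => decide (PP H v m t))).1
      (by omega)
    intro t ht
    simpa using h7 t ht
  obtain ⟨i, hi, j, hj, k, hk, hlt, hE⟩ := tri_code hv (hu e he) hes
  have pt : PP H v m (2 ^ i ||| (2 ^ j ||| 2 ^ k)) := ⟨hlt, by rw [hE]; exact he⟩
  have := allT_spec hall (i := i) (by omega) hj hk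
  rw [hP.viol (L := _ :: (core ++ L))] at this
  · simp only [Bool.or_false, Bool.or_eq_true, memN_iff, Bool.not_eq_true', ← Bool.not_eq_true, dz_iff] at this
    rw [← img_inter_empty hv hlt, ← img_inter_empty hv hlt, hE, img_two_pow (by omega)] at this
    rcases this with h | h | h
    · exact h
    · exact absurd (inter_ne_empty_singleton.1 h) hew
    · exact absurd hE (hec _ h)
  · intro y hy
    simp only [List.mem_cons, List.mem_append] at hy
    rcases hy with rfl | hy | hy
    · exact pt
    · exact hcore y hy
    · exact hfive y hy


theorem tri_pair {e U : Finset ℕ} {a b : ℕ} (he : e.card = 3) (ha : a ∈ e) (hb : b ∈ e) (hab : a ≠ b)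
    (hU : e ⊆ U) : ∃ w ∈ U \ {a, b}, e = {a, b, w} := by
  have h1 : (e \ {a, b}).card = 1 := by
    rw [card_sdiff_of_subset (by intro x; simp; rintro (rfl | rfl) <;> assumption), card_pair hab, he]
  obtain ⟨w, hw⟩ := card_eq_one.1 h1
  have hw' : w ∈ e \ {a, b} := by rw [hw]; simp
  rw [mem_sdiff] at hw'
  refine ⟨w, mem_sdiff.2 ⟨hU hw'.1, hw'.2⟩, ?_⟩
  ext x
  have : x ∈ e \ {a, b} ↔ x = w := by rw [hw]; simp
  simp only [mem_sdiff, mem_insert, mem_singleton] at this ⊢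
  constructor
  · intro hx; tauto
  · rintro (rfl | rfl | rfl)
    · exact ha
    · exact hb
    · exact hw'.1

theorem pair_count {F : Finset (Finset ℕ)} {U : Finset ℕ} {a b : ℕ} (hab : a ≠ b) (ha : a ∈ U) (hb : b ∈ U)
    (hF : ∀ e ∈ F, e.card = 3 ∧ e ⊆ U ∧ a ∈ e ∧ b ∈ e) : F.card ≤ U.card - 2 := by
  have hs : F ⊆ (U \ {a, b}).image (fun w => {a, b, w}) := by
    intro e he
    obtain ⟨h1, h2, h3, h4⟩ := hF e he
    obtain ⟨w, hw, rfl⟩ := tri_pair h1 h3 h4 hab h2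
    exact mem_image_of_mem _ hw
  refine (card_le_card hs).trans (card_image_le.trans ?_)
  rw [card_sdiff_of_subset (by intro x; simp; rintro (rfl | rfl) <;> assumption), card_pair hab]

theorem glue {V C K : Finset ℕ} {H E : Finset (Finset ℕ)} {n k B : ℕ} (hV : V.card = n) (hCV : C ⊆ V)
    (hk : C.card = k) (hk7 : 7 ≤ k) (hKC : K ⊆ C) (hu : ∀ e ∈ H, e.card = 3)
    (hE4 : E.card ≤ 4) (hEC : ∀ e ∈ E, e ⊆ C) (hne : k + 1 ≤ n)
    (hside : ∀ e ∈ H, e ⊆ C ∨ ∃ w ∈ V \ C, w ∈ e ∧ e ⊆ insert w C)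
    (SF1 : ∀ w ∈ V \ C, (H.filter (fun e => e ⊆ insert w C)).card ≤ B ∨
      ∃ x ∈ K, ∀ e ∈ H, e ⊆ insert w C → e ∉ E → x ∈ e)
    (SF2 : ∀ w ∈ V \ C, ∀ w' ∈ V \ C, w ≠ w' → (H.filter (fun e => w ∈ e)).card ≤ 4 ∨
      (H.filter (fun e => w' ∈ e)).card ≤ 4 ∨ ∃ x ∈ K, ∀ e ∈ H, (w ∈ e ∨ w' ∈ e) → x ∈ e)
    (SF3 : ∀ w ∈ V \ C, ∀ x ∈ K, (∀ e ∈ H, w ∈ e → x ∈ e) → 5 ≤ (H.filter (fun e => w ∈ e)).card →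
      ∀ e ∈ H, e ∉ E → x ∈ e)
    (hB : B + 4 * (n - k - 1) ≤ 4 * n - 11) :
    H.card ≤ 4 * n - 11 ∨ ∃ x ∈ K, ∀ e ∈ H, e ∉ E → x ∈ e := by
  set Lw : ℕ → ℕ := fun w => (H.filter (fun e => w ∈ e)).card with hLw
  set c := (H.filter (fun e => e ⊆ C)).card with hc
  have hVC : (V \ C).card = n - k := by rw [card_sdiff_of_subset hCV, hV, hk]
  have hcount : H.card ≤ c + ∑ w ∈ V \ C, Lw w := by
    have : H ⊆ H.filter (fun e => e ⊆ C) ∪ (V \ C).biUnion (fun w => H.filter (fun e => w ∈ e)) := by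
      intro e he
      rw [mem_union, mem_filter, mem_biUnion]
      rcases hside e he with h | ⟨w, hw, hwe, _⟩
      · exact Or.inl ⟨he, h⟩
      · exact Or.inr ⟨w, hw, by simp [he, hwe]⟩
    refine (card_le_card this).trans ((card_union_le _ _).trans ?_)
    exact Nat.add_le_add_left card_biUnion_le _
  have hcw : ∀ w ∈ V \ C, c + Lw w ≤ (H.filter (fun e => e ⊆ insert w C)).card := by
    intro w hw
    have hwC := (mem_sdiff.1 hw).2
    rw [hc, hLw, ← card_union_of_disjoint]
    · apply card_le_card
      intro e he
      rw [mem_union, mem_filter, mem_filter] at he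
      rw [mem_filter]
      rcases he with ⟨h1, h2⟩ | ⟨h1, h2⟩
      · exact ⟨h1, h2.trans (subset_insert _ _)⟩
      · refine ⟨h1, ?_⟩
        rcases hside e h1 with h | ⟨w', hw', _, h⟩
        · exact absurd (h h2) hwC
        · rcases mem_insert.1 (h h2) with rfl | h'
          · exact h
          · exact absurd h' hwC
    · rw [disjoint_left]
      intro e h1 h2
      rw [mem_filter] at h1 h2
      exact hwC (h1.2 h2.2)
  have done1 : ∀ w ∈ V \ C, (∀ w' ∈ V \ C, w' ≠ w → Lw w' ≤ 4) →
      (H.filter (fun e => e ⊆ insert w C)).card ≤ B → H.card ≤ 4 * n - 11 := by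
    intro w hw h4 hb
    have h1 := hcw w hw
    rw [← add_sum_erase _ _ hw] at hcount
    have h2 : ∑ x ∈ (V \ C).erase w, Lw x ≤ ((V \ C).erase w).card • 4 :=
      sum_le_card_nsmul _ _ _ (fun x hx => h4 x (mem_of_mem_erase hx) (ne_of_mem_erase hx))
    rw [card_erase_of_mem hw, hVC, smul_eq_mul] at h2
    omega
  by_cases h5 : ∃ w ∈ V \ C, 5 ≤ Lw w
  · obtain ⟨w, hw, hw5⟩ := h5
    by_cases h6 : ∃ w' ∈ V \ C, w' ≠ w ∧ 5 ≤ Lw w'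
    · obtain ⟨w', hw', hne', hw5'⟩ := h6
      rcases SF2 w hw w' hw' hne'.symm with h | h | ⟨x, hx, h⟩
      · simp only [hLw] at hw5; omega
      · simp only [hLw] at hw5'; omega
      · exact Or.inr ⟨x, hx, SF3 w hw x hx (fun e he hwe => h e he (Or.inl hwe)) hw5⟩
    · push Not at h6
      rcases SF1 w hw with h | ⟨x, hx, h⟩
      · exact Or.inl (done1 w hw (fun w' hw' hn => by have := h6 w' hw' hn; omega) h)
      · refine Or.inr ⟨x, hx, SF3 w hw x hx (fun e he hwe => ?_) hw5⟩
        have hwC := (mem_sdiff.1 hw).2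
        apply h e he
        · rcases hside e he with h | ⟨w', hw', _, h⟩
          · exact absurd (h hwe) hwC
          · rcases mem_insert.1 (h hwe) with rfl | h'
            · exact h
            · exact absurd h' hwC
        · intro hE; exact hwC (hEC e hE hwe)
  · push Not at h5
    by_cases h6 : ∃ w ∈ V \ C, (H.filter (fun e => e ⊆ insert w C)).card ≤ B
    · obtain ⟨w, hw, h⟩ := h6
      exact Or.inl (done1 w hw (fun w' hw' _ => by have := h5 w' hw'; omega) h)
    · push Not at h6
      have hx : ∀ w ∈ V \ C, ∃ x ∈ K, ∀ e ∈ H, e ⊆ insert w C → e ∉ E → x ∈ e := by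
        intro w hw
        rcases SF1 w hw with h | h
        · have := h6 w hw; omega
        · exact h
      obtain ⟨w0, hw0⟩ : (V \ C).Nonempty := card_pos.1 (by omega)
      obtain ⟨x, hxK, hx0⟩ := hx w0 hw0
      by_cases h7 : ∀ e ∈ H, e ∉ E → x ∈ e
      · exact Or.inr ⟨x, hxK, h7⟩
      · left
        push Not at h7
        obtain ⟨e1, he1, he1E, hxe1⟩ := h7
        obtain ⟨w1, hw1, he1w⟩ : ∃ w1 ∈ V \ C, e1 ⊆ insert w1 C := by
          rcases hside e1 he1 with h | ⟨w', hw', _, h⟩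
          · exact ⟨w0, hw0, h.trans (subset_insert _ _)⟩
          · exact ⟨w', hw', h⟩
        obtain ⟨y, hyK, hy⟩ := hx w1 hw1
        have hxy : x ≠ y := by
          rintro rfl
          exact hxe1 (hy e1 he1 he1w he1E)
        have hc' : c ≤ 4 + (k - 2) := by
          have hs : H.filter (fun e => e ⊆ C) ⊆ E ∪ (H.filter (fun e => e ⊆ C)) \ E := by
            intro e he; by_cases h : e ∈ E <;> simp [h, he]
          refine (card_le_card hs).trans ((card_union_le _ _).trans (Nat.add_le_add hE4 ?_))
          rw [← hk]
          apply pair_count hxy (hKC hxK) (hKC hyK)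
          intro e he
          rw [mem_sdiff, mem_filter] at he
          obtain ⟨⟨h1, h2⟩, h3⟩ := he
          exact ⟨hu e h1, h2, hx0 e h1 (h2.trans (subset_insert _ _)) h3,
            hy e h1 (h2.trans (subset_insert _ _)) h3⟩
        have h2 : ∑ x ∈ V \ C, Lw x ≤ (V \ C).card • 4 :=
          sum_le_card_nsmul _ _ _ (fun x hx => by have := h5 x hx; omega)
        rw [hVC, smul_eq_mul] at h2
        omega


theorem sp_of {V : Finset ℕ} {H : Finset (Finset ℕ)} (hH : ThreeGraphOn V H) (h1 : D1 H) {x : ℕ} (hx : x ∈ V)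
    {f1 f2 g : Finset ℕ} (hf1 : f1 ∈ H) (hf2 : f2 ∈ H) (hg : g ∈ H) (hx1 : x ∉ f1) (hx2 : x ∉ f2)
    (hc : (f1 ∩ f2).card = 1) (hg1 : g ∩ f1 = ∅) (hg2 : g ∩ f2 ≠ ∅)
    (hall : ∀ e ∈ H, e ≠ f1 → e ≠ f2 → x ∈ e) : SubSP V H := by
  refine ⟨_, ⟨x, hx, f1, f2, (hH f1 hf1).1, (hH f2 hf2).1, (hH f1 hf1).2, (hH f2 hf2).2, hc,
    by simp [hx1, hx2], rfl⟩, ?_⟩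
  intro e he
  rw [mem_union]
  by_cases e1 : e = f1
  · left; simp [e1]
  by_cases e2 : e = f2
  · left; simp [e2]
  right
  rw [mem_filter, mem_powersetCard]
  refine ⟨hH e he, hall e he e1 e2, ?_⟩
  rw [nonempty_iff_ne_empty]
  intro h
  rw [inter_union_distrib_left, union_eq_empty] at h
  apply hg2
  exact h1 g hg f1 hf1 e he f2 hf2 hg1 (by rw [inter_comm]; exact h.1) h.2

def spOK (core : List ℕ) (cs i : ℕ) : Prop := ∃ c1 ∈ core, ∃ c2 ∈ core, ∃ g ∈ core,
  c1 &&& 2 ^ i = 0 ∧ c2 &&& 2 ^ i = 0 ∧ g &&& c1 = 0 ∧ g &&& c2 ≠ 0 ∧ (∃ j < cs, c1 &&& c2 = 2 ^ j) ∧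
  ∀ c ∈ core, c ≠ c1 → c ≠ c2 → c &&& 2 ^ i ≠ 0

instance (core : List ℕ) (cs i : ℕ) : Decidable (spOK core cs i) := by unfold spOK; infer_instance

theorem mem_img_iff_and {u : ℕ → ℕ} {cs c i : ℕ} (hu : InjR u cs) (hc : c < 2 ^ cs) (hi : i < cs) :
    u i ∈ img u cs c ↔ c &&& 2 ^ i ≠ 0 := by
  rw [Ne, ← img_inter_empty hu hc, img_two_pow hi]
  exact inter_ne_empty_singleton.symm

theorem sp_core {V : Finset ℕ} {H : Finset (Finset ℕ)} (hH : ThreeGraphOn V H) (h1 : D1 H)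
    {u : ℕ → ℕ} {cs : ℕ} (hu : InjR u cs) {core : List ℕ} (hcore : ∀ c ∈ core, PP H u cs c)
    {i : ℕ} (hi : i < cs) (hx : u i ∈ V) (hsp : spOK core cs i)
    (hall : ∀ e ∈ H, e ∉ (core.map (img u cs)).toFinset → u i ∈ e) : SubSP V H := by
  obtain ⟨c1, k1, c2, k2, g, kg, a1, a2, a3, a4, ⟨j, hj, a5⟩, a6⟩ := hsp
  refine sp_of hH h1 hx (hcore c1 k1).2 (hcore c2 k2).2 (hcore g kg).2 ?_ ?_ ?_ ?_ ?_ ?_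
  · rw [mem_img_iff_and hu (hcore c1 k1).1 hi]; simpa using a1
  · rw [mem_img_iff_and hu (hcore c2 k2).1 hi]; simpa using a2
  · rw [img_inter hu, a5, img_two_pow hj]; simp
  · rw [img_inter_empty hu (hcore g kg).1]; exact a3
  · rw [Ne, img_inter_empty hu (hcore g kg).1]; exact a4
  · intro e he e1 e2
    by_cases hE : e ∈ (core.map (img u cs)).toFinset
    · rw [List.mem_toFinset, List.mem_map] at hE
      obtain ⟨c, hc, rfl⟩ := hE
      rw [mem_img_iff_and hu (hcore c hc).1 hi]
      exact a6 c hc (fun h => e1 (by rw [h])) (fun h => e2 (by rw [h]))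
    · exact hall e he hE

theorem img_agree {u v : ℕ → ℕ} {cs m c : ℕ} (hm : cs ≤ m) (h : ∀ i < cs, v i = u i) (hc : c < 2 ^ cs) :
    img v m c = img u cs c := by
  rw [← img_ext hm hc]
  unfold img
  apply image_congr
  intro i hi
  simp only [coe_filter, mem_range, Set.mem_ofPred_eq] at hi
  exact h i hi.1

theorem core_case0 {V : Finset ℕ} {H : Finset (Finset ℕ)} (hH : ThreeGraphOn V H) (h1 : D1 H) (h3 : D3 H)
    {u : ℕ → ℕ} {cs k b : ℕ} (hu : InjR u cs) {core : List ℕ} (hcore : ∀ c ∈ core, PP H u cs c)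
    (hlen : core.length = 4) (hVu : V = (range cs).image u) {T : List Ent} {is : List ℕ}
    (his : ∀ i ∈ is, i < cs ∧ spOK core cs i) (hcs : cs ≤ 10)
    (htab : tabOK core T = true) (hcov : covOK core T (fun _ => true) cs = true)
    (hgo : go 1023 1023 b b k T 0 0 (is.map (2 ^ ·)) core = true) :
    H.card ≤ b + 4 ∨ SubSP V H := by
  set E := (core.map (img u cs)).toFinset with hE
  have hne : ∀ e ∈ H \ E, e ∩ img u cs 1023 ≠ ∅ := by
    intro e he
    rw [mem_sdiff] at he
    obtain ⟨hs, hc⟩ := hH e he.1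
    obtain ⟨x, hx⟩ : e.Nonempty := card_pos.1 (by omega)
    rw [← nonempty_iff_ne_empty]
    refine ⟨x, mem_inter.2 ⟨hx, ?_⟩⟩
    rw [hVu] at hs
    obtain ⟨i, hi, rfl⟩ := mem_image.1 (hs hx)
    rw [mem_range] at hi
    rw [img_mem_iff hu hi]
    rw [show 1023 = 2 ^ 10 - 1 by norm_num, Nat.testBit_two_pow_sub_one]
    simp; omega
  have := model_search hu h1 h3 (fun e he => (hH e he).2) htab hcov hgo hcore (H \ E) (H \ E) (H \ E)
    sdiff_subset (fun e he => by rw [← hVu]; exact (hH e (mem_sdiff.1 he).1).1)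
    (fun e he c hc h => (mem_sdiff.1 he).2 (by rw [hE, List.mem_toFinset, List.mem_map]; exact ⟨c, hc, h⟩))
    (fun _ _ _ => rfl) (Subset.refl _) (Subset.refl _) hne hne
  have hE4 : E.card ≤ 4 := by
    refine (List.toFinset_card_le _).trans ?_
    simp [hlen]
  have key : (H \ E).card ≤ b → H.card ≤ b + 4 := by
    intro h
    have : H ⊆ (H \ E) ∪ E := by intro e he; by_cases h : e ∈ E <;> simp [h, he]
    have := (card_le_card this).trans (card_union_le _ _)
    omega
  rcases this with h | h | ⟨x, hx, h⟩
  · exact Or.inl (key h)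
  · exact Or.inl (key h)
  · right
    obtain ⟨i, hi, rfl⟩ := List.mem_map.1 hx
    obtain ⟨hi1, hi2⟩ := his i hi
    refine sp_core hH h1 hu hcore hi1 (by rw [hVu]; exact mem_image_of_mem _ (mem_range.2 hi1)) hi2 ?_
    intro e he heE
    have := h e (mem_sdiff.2 ⟨he, heE⟩)
    rw [img_two_pow hi1] at this
    exact inter_ne_empty_singleton.1 this

def vw (u : ℕ → ℕ) (cs w w' : ℕ) : ℕ → ℕ := fun i => if i < cs then u i else if i = cs then w else w'

theorem vw_u {u : ℕ → ℕ} {cs w w' : ℕ} : ∀ i < cs, vw u cs w w' i = u i := by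
  intro i hi; simp [vw, hi]
theorem vw_w {u : ℕ → ℕ} {cs w w' : ℕ} : vw u cs w w' cs = w := by simp [vw]
theorem vw_w' {u : ℕ → ℕ} {cs w w' : ℕ} : vw u cs w w' (cs + 1) = w' := by simp [vw]

theorem vw_image1 {u : ℕ → ℕ} {cs w w' : ℕ} :
    (range (cs + 1)).image (vw u cs w w') = insert w ((range cs).image u) := by
  rw [range_add_one, image_insert, vw_w]
  congr 1
  apply image_congr
  intro i hi
  exact vw_u i (by simpa using hi)

theorem vw_image2 {u : ℕ → ℕ} {cs w w' : ℕ} :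
    (range (cs + 2)).image (vw u cs w w') = insert w' (insert w ((range cs).image u)) := by
  rw [range_add_one, image_insert, vw_w', vw_image1]

theorem vw_inj1 {u : ℕ → ℕ} {cs w w' : ℕ} (hu : InjR u cs) (hw : w ∉ (range cs).image u) :
    InjR (vw u cs w w') (cs + 1) := by
  have hw' : ∀ i < cs, u i ≠ w := fun i hi h => hw (mem_image.2 ⟨i, mem_range.2 hi, h⟩)
  intro i hi j hj h
  rcases Nat.lt_succ_iff_lt_or_eq.1 hi with hi | rfl <;> rcases Nat.lt_succ_iff_lt_or_eq.1 hj with hj | rfl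
  · rw [vw_u i hi, vw_u j hj] at h; exact hu i hi j hj h
  · rw [vw_u i hi, vw_w] at h; exact absurd h (hw' i hi)
  · rw [vw_u j hj, vw_w] at h; exact absurd h.symm (hw' j hj)
  · rfl

theorem vw_inj2 {u : ℕ → ℕ} {cs w w' : ℕ} (hu : InjR u cs) (hw : w ∉ (range cs).image u)
    (hww : w' ∉ insert w ((range cs).image u)) :
    InjR (vw u cs w w') (cs + 2) := by
  have h1 := vw_inj1 (w' := w') hu hw
  rw [← vw_image1 (w' := w')] at hww
  have hw' : ∀ i < cs + 1, vw u cs w w' i ≠ w' := fun i hi h => hww (mem_image.2 ⟨i, mem_range.2 hi, h⟩)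
  intro i hi j hj h
  rcases Nat.lt_succ_iff_lt_or_eq.1 hi with hi | rfl <;> rcases Nat.lt_succ_iff_lt_or_eq.1 hj with hj | rfl
  · exact h1 i hi j hj h
  · rw [vw_w'] at h; exact absurd h (hw' i hi)
  · rw [vw_w'] at h; exact absurd h.symm (hw' j hj)
  · rfl


theorem core_case {V : Finset ℕ} {H : Finset (Finset ℕ)} {n : ℕ} (hV : V.card = n) (hH : ThreeGraphOn V H)
    (h1 : D1 H) (h3 : D3 H)
    {u : ℕ → ℕ} {cs k k' b : ℕ} (hu : InjR u cs) {core : List ℕ} (hcore : ∀ c ∈ core, PP H u cs c)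
    (hlen : core.length = 4) (hVu : (range cs).image u ⊆ V) {T T2 : List Ent} {is : List ℕ}
    (his : ∀ i ∈ is, i < cs ∧ spOK core cs i) (hcs : cs ≤ 9) (hcs7 : 7 ≤ cs) (hn : cs + 1 ≤ n)
    (hb : b + 4 ≤ 4 * (cs + 1) - 11)
    (hside : ∀ e ∈ H, e ⊆ (range cs).image u ∨
      ∃ w ∈ V \ (range cs).image u, w ∈ e ∧ e ⊆ insert w ((range cs).image u))
    (htab : tabOK core T = true) (hcov : covOK core T (fun _ => true) (cs + 1) = true)
    (hgo : go 1023 1023 b b k T 0 0 (is.map (2 ^ ·)) core = true)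
    (htab2 : tabOK core T2 = true) (hcov2 : covOK core T2 (q2 cs) (cs + 2) = true)
    (hgo2 : go (2 ^ cs) (2 ^ (cs + 1)) 4 4 k' T2 0 0 (is.map (2 ^ ·)) core = true)
    (hf3 : f3OK core T cs (cs + 2) (is.map (2 ^ ·)) = true) :
    H.card ≤ 4 * n - 11 ∨ SubSP V H := by
  set C := (range cs).image u with hC
  set E := (core.map (img u cs)).toFinset with hE
  have hCcard : C.card = cs := by
    rw [hC, card_image_of_injOn, card_range]
    intro i hi j hj h
    exact hu i (by simpa using hi) j (by simpa using hj) h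
  have hcard : ∀ e ∈ H, e.card = 3 := fun e he => (hH e he).2
  have hE4 : E.card ≤ 4 := by
    refine (List.toFinset_card_le _).trans ?_
    simp [hlen]
  have hEC : ∀ e ∈ E, e ⊆ C := by
    intro e he
    rw [hE, List.mem_toFinset, List.mem_map] at he
    obtain ⟨c, _, rfl⟩ := he
    exact image_subset_image (filter_subset _ _)
  have hwe : ∀ w ∈ V \ C, ∀ e ∈ H, w ∈ e → e ⊆ insert w C := by
    intro w hw e he hwe
    have hwC := (mem_sdiff.1 hw).2
    rcases hside e he with h | ⟨w', hw', _, h⟩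
    · exact absurd (h hwe) hwC
    · rcases mem_insert.1 (h hwe) with rfl | h'
      · exact h
      · exact absurd h' hwC
  have hcoreP : ∀ (w w' m : ℕ), cs ≤ m → ∀ c ∈ core, PP H (vw u cs w w') m c := by
    intro w w' m hm c hc
    obtain ⟨a1, a2⟩ := hcore c hc
    refine ⟨lt_of_lt_of_le a1 (Nat.pow_le_pow_right (by norm_num) hm), ?_⟩
    rw [img_agree hm vw_u a1]; exact a2
  have hnotE : ∀ (w w' m : ℕ), cs ≤ m → ∀ e, e ∉ E → ∀ c ∈ core, img (vw u cs w w') m c ≠ e := by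
    intro w w' m hm e he c hc h
    apply he
    rw [img_agree hm vw_u (hcore c hc).1] at h
    rw [hE, List.mem_toFinset, List.mem_map]
    exact ⟨c, hc, h⟩
  have hgl := glue (V := V) (C := C) (K := (is.map u).toFinset) (H := H) (E := E) (n := n) (k := cs) (B := b + 4)
    hV hVu hCcard hcs7 (by
      intro x hx
      rw [List.mem_toFinset, List.mem_map] at hx
      obtain ⟨i, hi, rfl⟩ := hx
      exact mem_image_of_mem _ (mem_range.2 (his i hi).1)) hcard hE4 hEC hn hside ?_ ?_ ?_ (by omega)
  · rcases hgl with h | ⟨x, hx, h⟩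
    · exact Or.inl h
    · right
      rw [List.mem_toFinset, List.mem_map] at hx
      obtain ⟨i, hi, rfl⟩ := hx
      obtain ⟨hi1, hi2⟩ := his i hi
      exact sp_core hH h1 hu hcore hi1 (hVu (mem_image_of_mem _ (mem_range.2 hi1))) hi2 h
  · -- SF1
    intro w hw
    have hwC := (mem_sdiff.1 hw).2
    have hv := vw_inj1 (w' := w) hu hwC
    set F := (H.filter (fun e => e ⊆ insert w C)) \ E with hF
    have hFm : ∀ e ∈ F, e ∈ H ∧ e ⊆ insert w C ∧ e ∉ E := by
      intro e he
      rw [hF, mem_sdiff, mem_filter] at he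
      tauto
    have hne : ∀ e ∈ F, e ∩ img (vw u cs w w) (cs + 1) 1023 ≠ ∅ := by
      intro e he
      obtain ⟨he, hs, -⟩ := hFm e he
      obtain ⟨x, hx⟩ : e.Nonempty := card_pos.1 (by rw [hcard e he]; norm_num)
      rw [← nonempty_iff_ne_empty]
      refine ⟨x, mem_inter.2 ⟨hx, ?_⟩⟩
      rw [hC, ← vw_image1 (w' := w)] at hs
      obtain ⟨i, hi, rfl⟩ := mem_image.1 (hs hx)
      rw [mem_range] at hi
      rw [img_mem_iff hv hi]
      rw [show 1023 = 2 ^ 10 - 1 by norm_num, Nat.testBit_two_pow_sub_one]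
      simp; omega
    have := model_search hv h1 h3 hcard htab hcov hgo (hcoreP w w _ (by omega)) F F F
      (fun e he => (hFm e he).1) (fun e he => by rw [vw_image1]; exact (hFm e he).2.1)
      (fun e he => hnotE w w _ (by omega) e (hFm e he).2.2)
      (fun _ _ _ => rfl) (Subset.refl _) (Subset.refl _) hne hne
    have key : F.card ≤ b → (H.filter (fun e => e ⊆ insert w C)).card ≤ b + 4 := by
      intro h
      have : H.filter (fun e => e ⊆ insert w C) ⊆ F ∪ E := by
        intro e he; by_cases h : e ∈ E <;> simp [h, he, hF]
      have := (card_le_card this).trans (card_union_le _ _)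
      omega
    rcases this with h | h | ⟨x, hx, h⟩
    · exact Or.inl (key h)
    · exact Or.inl (key h)
    · right
      obtain ⟨i, hi, rfl⟩ := List.mem_map.1 hx
      obtain ⟨hi1, hi2⟩ := his i hi
      refine ⟨u i, by rw [List.mem_toFinset]; exact List.mem_map_of_mem hi, ?_⟩
      intro e he hew heE
      have := h e (by rw [hF, mem_sdiff, mem_filter]; exact ⟨⟨he, hew⟩, heE⟩)
      rw [img_two_pow (by omega), vw_u i hi1] at this
      exact inter_ne_empty_singleton.1 this
  · -- SF2
    intro w hw w' hw' hww
    have hwC := (mem_sdiff.1 hw).2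
    have hwC' := (mem_sdiff.1 hw').2
    have hv := vw_inj2 (w' := w') hu hwC (by
      rw [mem_insert, not_or]; exact ⟨hww.symm, hwC'⟩)
    set F := H.filter (fun e => w ∈ e) with hF
    set F' := H.filter (fun e => w' ∈ e) with hF'
    have hone : ∀ e ∈ H, w ∈ e → w' ∉ e := by
      intro e he h h'
      rcases mem_insert.1 (hwe w hw e he h h') with h | h
      · exact hww h.symm
      · exact hwC' h
    have := model_search hv h1 h3 hcard htab2 hcov2 hgo2 (hcoreP w w' _ (by omega)) (F ∪ F') F F'
      (union_subset (filter_subset _ _) (filter_subset _ _)) (by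
        intro e he
        rw [vw_image2]
        rw [mem_union, mem_filter, mem_filter] at he
        rcases he with he | he
        · exact (hwe w hw e he.1 he.2).trans (subset_insert _ _)
        · exact (hwe w' hw' e he.1 he.2).trans (insert_subset_insert _ (subset_insert _ _))) (by
        intro e he
        apply hnotE w w' _ (by omega) e
        intro h
        rw [mem_union, mem_filter, mem_filter] at he
        rcases he with he | he
        · exact hwC (hEC e h he.2)
        · exact hwC' (hEC e h he.2)) (by
        intro t ht hG
        rw [mem_union, mem_filter, mem_filter] at hG
        have e1 : (w ∈ img (vw u cs w w') (cs + 2) t) ↔ ¬ dz t (2 ^ cs) = true := by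
          rw [dz_iff, ← img_inter_empty hv ht, img_two_pow (by omega), vw_w]
          exact inter_ne_empty_singleton.symm
        have e2 : (w' ∈ img (vw u cs w w') (cs + 2) t) ↔ ¬ dz t (2 ^ (cs + 1)) = true := by
          rw [dz_iff, ← img_inter_empty hv ht, img_two_pow (by omega), vw_w']
          exact inter_ne_empty_singleton.symm
        have e3 := hone (img (vw u cs w w') (cs + 2) t)
        unfold q2
        revert e1 e2
        cases dz t (2 ^ cs) <;> cases dz t (2 ^ (cs + 1)) <;> simp <;> tauto)
      subset_union_left subset_union_right (by
        intro e he
        rw [img_two_pow (by omega), vw_w]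
        exact inter_ne_empty_singleton.2 (mem_filter.1 he).2) (by
        intro e he
        rw [img_two_pow (by omega), vw_w']
        exact inter_ne_empty_singleton.2 (mem_filter.1 he).2)
    rcases this with h | h | ⟨x, hx, h⟩
    · exact Or.inl h
    · exact Or.inr (Or.inl h)
    · right; right
      obtain ⟨i, hi, rfl⟩ := List.mem_map.1 hx
      obtain ⟨hi1, hi2⟩ := his i hi
      refine ⟨u i, by rw [List.mem_toFinset]; exact List.mem_map_of_mem hi, ?_⟩
      intro e he hew
      have := h e (by rw [mem_union, mem_filter, mem_filter]; tauto)
      rw [img_two_pow (by omega), vw_u i hi1] at this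
      exact inter_ne_empty_singleton.1 this
  · -- SF3
    intro w hw x hx hwx hw5 e he heE
    have hwC := (mem_sdiff.1 hw).2
    rw [List.mem_toFinset, List.mem_map] at hx
    obtain ⟨i, hi, rfl⟩ := hx
    obtain ⟨hi1, hi2⟩ := his i hi
    by_cases hwe' : w ∈ e
    · exact hwx e he hwe'
    have main : ∀ (w' m : ℕ), cs + 1 ≤ m → m ≤ cs + 2 → InjR (vw u cs w w') m →
        e ⊆ (range m).image (vw u cs w w') → u i ∈ e := by
      intro w' m hm1 hm2 hv hes
      have := model_f3 hv h1 h3 hcard hm1 hcov hm2 hf3 (hcoreP w w' _ (by omega)) (2 ^ i)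
        (List.mem_map_of_mem (f := (2 ^ ·)) hi) (H.filter (fun e => w ∈ e)) (filter_subset _ _)
        (fun f hf => by rw [vw_image1]; exact hwe w hw f (mem_filter.1 hf).1 (mem_filter.1 hf).2)
        (fun f hf => hnotE w w' _ (by omega) f (fun h => hwC (hEC f h (mem_filter.1 hf).2)))
        (fun f hf => by rw [vw_w]; exact (mem_filter.1 hf).2)
        (fun f hf => by
          rw [img_two_pow (by omega), vw_u i hi1]
          exact inter_ne_empty_singleton.2 (hwx f (mem_filter.1 hf).1 (mem_filter.1 hf).2))
        hw5 e he hes (by rw [vw_w]; exact hwe') (hnotE w w' _ (by omega) e heE)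
      rw [img_two_pow (by omega), vw_u i hi1] at this
      exact inter_ne_empty_singleton.1 this
    rcases hside e he with h | ⟨w', hw', hwe2, h⟩
    · exact main w (cs + 1) le_rfl (by omega) (vw_inj1 hu hwC) (by
        rw [vw_image1]; exact h.trans (subset_insert _ _))
    · have hww : w' ≠ w := by rintro rfl; exact hwe' hwe2
      refine main w' (cs + 2) (by omega) le_rfl (vw_inj2 hu hwC ?_) ?_
      · rw [mem_insert, not_or]; exact ⟨hww, (mem_sdiff.1 hw').2⟩
      · rw [vw_image2]; exact h.trans (insert_subset_insert _ (subset_insert _ _))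


theorem ne_of_inter {a b : Finset ℕ} {x y : ℕ} (h : a ∩ b = ∅) (hx : x ∈ a) (hy : y ∈ b) : x ≠ y := by
  rintro rfl
  have : x ∈ a ∩ b := mem_inter.2 ⟨hx, hy⟩
  rw [h] at this; simp at this

theorem not_mem_of_inter {a b : Finset ℕ} {x : ℕ} (h : a ∩ b = ∅) (hx : x ∈ a) : x ∉ b :=
  fun hy => ne_of_inter h hx hy rfl

theorem mkD1 {H : Finset (Finset ℕ)} (hfree : P4Free H) (hM3 : ¬HasM3 H) : D1 H := by
  intro a ha b hb c hc d hd hab hbc hcd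
  by_contra h
  apply hfree
  refine ⟨c, hc, a, ha, d, hd, b, hb, ?_, nonempty_iff_ne_empty.2 h, ?_, hcd, by rwa [inter_comm], hab⟩
  · rw [nonempty_iff_ne_empty]; intro h'
    exact hM3 ⟨a, ha, b, hb, c, hc, hab, by rwa [inter_comm], hbc⟩
  · rw [nonempty_iff_ne_empty]; intro h'
    exact hM3 ⟨b, hb, c, hc, d, hd, hbc, by rwa [inter_comm], hcd⟩

theorem mkC4 {H : Finset (Finset ℕ)} {a b c d : Finset ℕ} (ha : a ∈ H) (hb : b ∈ H) (hc : c ∈ H) (hd : d ∈ H)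
    (ca : a.card = 3) (cb : b.card = 3) (cc : c.card = 3) (cd : d.card = 3)
    (hab : a ∩ b = ∅) (hcd : c ∩ d = ∅) (hu : a ∪ b = c ∪ d) (h2 : (a ∩ c).card = 2) : HasC4 H := by
  obtain ⟨y1, y2, hy, hac⟩ := card_eq_two.1 h2
  have y1m : y1 ∈ a ∩ c := by rw [hac]; simp
  have y2m : y2 ∈ a ∩ c := by rw [hac]; simp
  rw [mem_inter] at y1m y2m
  obtain ⟨x1, hx1, ea⟩ := tri_pair ca y1m.1 y2m.1 hy (Subset.refl _)
  obtain ⟨x2, hx2, ec⟩ := tri_pair cc y1m.2 y2m.2 hy (Subset.refl _)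
  rw [mem_sdiff] at hx1 hx2
  have x1c : x1 ∉ c := fun h => hx1.2 (by rw [← hac]; exact mem_inter.2 ⟨hx1.1, h⟩)
  have x2a : x2 ∉ a := fun h => hx2.2 (by rw [← hac]; exact mem_inter.2 ⟨h, hx2.1⟩)
  have x1d : x1 ∈ d := by
    have : x1 ∈ c ∪ d := by rw [← hu]; exact mem_union_left _ hx1.1
    exact (mem_union.1 this).resolve_left x1c
  have x2b : x2 ∈ b := by
    have : x2 ∈ a ∪ b := by rw [hu]; exact mem_union_left _ hx2.1
    exact (mem_union.1 this).resolve_left x2a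
  obtain ⟨z1, z2, hz, hdz⟩ := card_eq_two.1 (show (d.erase x1).card = 2 by rw [card_erase_of_mem x1d, cd])
  have hdz' : d = {x1, z1, z2} := by rw [← hdz, insert_erase x1d]
  have hzd : ∀ z, z ∈ d → z ≠ x1 → z ∈ b := by
    intro z hzd hzx
    have : z ∈ a ∪ b := by rw [hu]; exact mem_union_right _ hzd
    refine (mem_union.1 this).resolve_left ?_
    intro hza
    rw [ea] at hza
    simp only [mem_insert, mem_singleton] at hza
    rcases hza with rfl | rfl | rfl
    · exact not_mem_of_inter hcd y1m.2 hzd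
    · exact not_mem_of_inter hcd y2m.2 hzd
    · exact hzx rfl
  have z1m : z1 ∈ d.erase x1 := by rw [hdz]; simp
  have z2m : z2 ∈ d.erase x1 := by rw [hdz]; simp
  rw [mem_erase] at z1m z2m
  have z1b := hzd z1 z1m.2 z1m.1
  have z2b := hzd z2 z2m.2 z2m.1
  have x2d : x2 ∉ d := not_mem_of_inter hcd hx2.1
  have hx2z1 : x2 ≠ z1 := by rintro rfl; exact x2d z1m.2
  have hx2z2 : x2 ≠ z2 := by rintro rfl; exact x2d z2m.2
  have hbz : ({x2, z1, z2} : Finset ℕ) = b := by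
    apply eq_of_subset_of_card_le
    · intro x; simp only [mem_insert, mem_singleton]; rintro (rfl | rfl | rfl) <;> assumption
    · rw [cb, card_eq_three.2 ⟨x2, z1, z2, hx2z1, hx2z2, hz, rfl⟩]
  refine ⟨x1, x2, y1, y2, z1, z2, ?_, ?_, ?_, ?_, ?_⟩
  · have e1 := ne_of_inter hab hx1.1 x2b
    have e2 : x1 ≠ y1 := by rintro rfl; simp at hx1
    have e3 : x1 ≠ y2 := by rintro rfl; simp at hx1
    have e4 := ne_of_inter hab y1m.1 x2b
    have e5 := ne_of_inter hab y2m.1 x2b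
    have e6 := ne_of_inter hab y1m.1 z1b
    have e7 := ne_of_inter hab y2m.1 z1b
    have e8 := ne_of_inter hab y1m.1 z2b
    have e9 := ne_of_inter hab y2m.1 z2b
    have e10 := ne_of_inter hab hx1.1 z1b
    have e11 := ne_of_inter hab hx1.1 z2b
    have : [x1, x2, y1, y2, z1, z2].toFinset.card = 6 := by
      rw [List.toFinset_card_of_nodup]
      · rfl
      · simp; tauto
    simpa using this
  · rw [show ({x1, y1, y2} : Finset ℕ) = a by rw [ea]; ext; simp; tauto]; exact ha
  · rw [← ec]; exact hc
  · rw [hbz]; exact hb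
  · rw [show ({z1, z2, x1} : Finset ℕ) = d by rw [hdz']; ext; simp; tauto]; exact hd

theorem mkD3 {H : Finset (Finset ℕ)} (hu : ∀ e ∈ H, e.card = 3) (hC4 : ¬HasC4 H) : D3 H := by
  intro a ha b hb c hc d hd hab hcd hU
  by_contra hne
  rw [not_or] at hne
  have key : ∀ a ∈ H, ∀ b ∈ H, ∀ c ∈ H, ∀ d ∈ H, a ∩ b = ∅ → c ∩ d = ∅ → a ∪ b = c ∪ d → a ≠ d → a ∩ c ≠ ∅ := by
    intro a ha b hb c hc d hd hab hcd hU hne h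
    apply hne
    apply eq_of_subset_of_card_le
    · intro x hx
      have : x ∈ c ∪ d := by rw [← hU]; exact mem_union_left _ hx
      exact (mem_union.1 this).resolve_left (not_mem_of_inter h hx)
    · rw [hu a ha, hu d hd]
  have hdc : d ∩ c = ∅ := by rwa [inter_comm]
  have hU' : a ∪ b = d ∪ c := by rw [hU, union_comm]
  have k1 := key a ha b hb c hc d hd hab hcd hU hne.2
  have k2 := key a ha b hb d hd c hc hab hdc hU' hne.1
  rw [← nonempty_iff_ne_empty, ← card_pos] at k1 k2
  have k3 : (a ∩ c).card + (a ∩ d).card = 3 := by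
    rw [← card_union_of_disjoint, ← inter_union_distrib_left, ← hU, inter_eq_left.2 subset_union_left, hu a ha]
    rw [disjoint_left]
    intro x h1 h2
    exact not_mem_of_inter hcd (mem_inter.1 h1).2 (mem_inter.1 h2).2
  have : (a ∩ c).card = 2 ∨ (a ∩ d).card = 2 := by omega
  rcases this with h | h
  · exact hC4 (mkC4 ha hb hc hd (hu a ha) (hu b hb) (hu c hc) (hu d hd) hab hcd hU h)
  · exact hC4 (mkC4 ha hb hd hc (hu a ha) (hu b hb) (hu d hd) (hu c hc) hab hdc hU' h)

theorem side_of {V C : Finset ℕ} {H : Finset (Finset ℕ)} (hH : ThreeGraphOn V H) (h1 : D1 H)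
    {e1 f1 e2 f2 : Finset ℕ} (he1 : e1 ∈ H) (hf1 : f1 ∈ H) (he2 : e2 ∈ H) (hf2 : f2 ∈ H)
    (d1 : e1 ∩ f1 = ∅) (d2 : e2 ∩ f2 = ∅) (x11 : e1 ∩ e2 ≠ ∅) (x12 : e1 ∩ f2 ≠ ∅) (x21 : f1 ∩ e2 ≠ ∅)
    (x22 : f1 ∩ f2 ≠ ∅) (c1 : e1 ⊆ C) (c2 : f1 ⊆ C) (c3 : e2 ⊆ C) (c4 : f2 ⊆ C) (g : Finset ℕ) (hg : g ∈ H) :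
    g ⊆ C ∨ ∃ w ∈ V \ C, w ∈ g ∧ g ⊆ insert w C := by
  have d1' : f1 ∩ e1 = ∅ := by rwa [inter_comm]
  have d2' : f2 ∩ e2 = ∅ := by rwa [inter_comm]
  have key : ∀ a b, a ∩ b = ∅ → a ⊆ C → b ⊆ C → g ∩ a ≠ ∅ → g ∩ b ≠ ∅ →
      g ⊆ C ∨ ∃ w ∈ V \ C, w ∈ g ∧ g ⊆ insert w C := by
    intro a b hab ha hb hga hgb
    obtain ⟨x, hx⟩ := nonempty_iff_ne_empty.2 hga
    obtain ⟨y, hy⟩ := nonempty_iff_ne_empty.2 hgb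
    rw [mem_inter] at hx hy
    obtain ⟨w, hw, hgw⟩ := tri_pair (hH g hg).2 hx.1 hy.1 (ne_of_inter hab hx.2 hy.2) (hH g hg).1
    have hw' : w ∈ g := by rw [hgw]; simp
    have hs : g ⊆ insert w C := by
      intro z hz
      rw [hgw] at hz
      simp only [mem_insert, mem_singleton] at hz ⊢
      rcases hz with rfl | rfl | rfl
      · exact Or.inr (ha hx.2)
      · exact Or.inr (hb hy.2)
      · exact Or.inl rfl
    by_cases hwC : w ∈ C
    · left; rwa [insert_eq_of_mem hwC] at hs
    · right; exact ⟨w, mem_sdiff.2 ⟨(hH g hg).1 hw', hwC⟩, hw', hs⟩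
  by_cases a1 : g ∩ e1 ≠ ∅ ∧ g ∩ f1 ≠ ∅
  · exact key e1 f1 d1 c1 c2 a1.1 a1.2
  by_cases a2 : g ∩ e2 ≠ ∅ ∧ g ∩ f2 ≠ ∅
  · exact key e2 f2 d2 c3 c4 a2.1 a2.2
  exfalso
  rw [not_and_or, not_not, not_not] at a1 a2
  rcases a1 with a1 | a1 <;> rcases a2 with a2 | a2 <;> rw [inter_comm] at a1
  · exact x21 (h1 f1 hf1 e1 he1 g hg e2 he2 d1' a1 a2)
  · exact x22 (h1 f1 hf1 e1 he1 g hg f2 hf2 d1' a1 a2)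
  · exact x11 (h1 e1 he1 f1 hf1 g hg e2 he2 d1 a1 a2)
  · exact x12 (h1 e1 he1 f1 hf1 g hg f2 hf2 d1 a1 a2)

theorem injR_of_nodup {l : List ℕ} (h : l.Nodup) : InjR (fun i => l.getD i 0) l.length := by
  intro i hi j hj hij
  simp only [List.getD_eq_getElem?_getD, List.getElem?_eq_getElem hi, List.getElem?_eq_getElem hj,
    Option.getD_some] at hij
  exact (h.getElem_inj_iff).1 hij

theorem case_alpha {V : Finset ℕ} {H : Finset (Finset ℕ)} {n : ℕ} (hn : 8 ≤ n) (hV : V.card = n)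
    (hH : ThreeGraphOn V H) (h1 : D1 H) (h3 : D3 H) {p q r s a b c d : ℕ}
    (hnd : [p, q, r, s, a, b, c, d].Nodup) (he1 : {p, q, a} ∈ H) (hf1 : {r, s, b} ∈ H) (he2 : {p, r, c} ∈ H)
    (hf2 : {q, s, d} ∈ H)
    (hside : ∀ C : Finset ℕ, {p, q, a} ⊆ C → {r, s, b} ⊆ C → {p, r, c} ⊆ C → {q, s, d} ⊆ C → ∀ g ∈ H, 
      g ⊆ C ∨ ∃ w ∈ V \ C, w ∈ g ∧ g ⊆ insert w C) :
    H.card ≤ 4 * n - 11 ∨ SubSP V H := by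
  set l := [p, q, r, s, a, b, c, d] with hl
  set u : ℕ → ℕ := fun i => l.getD i 0 with hu
  have hinj : InjR u 8 := injR_of_nodup hnd
  have hC : (range 8).image u = {p, q, r, s, a, b, c, d} := by
    rw [show range 8 = {0, 1, 2, 3, 4, 5, 6, 7} by decide]
    simp [hu, hl]
  have g1 : img u 8 19 = {p, q, a} := by
    unfold img; rw [show (range 8).filter (fun i => Nat.testBit 19 i = true) = {0, 1, 4} by decide]
    simp [hu, hl]
  have g2 : img u 8 44 = {r, s, b} := by
    unfold img; rw [show (range 8).filter (fun i => Nat.testBit 44 i = true) = {2, 3, 5} by decide]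
    simp [hu, hl]
  have g3 : img u 8 69 = {p, r, c} := by
    unfold img; rw [show (range 8).filter (fun i => Nat.testBit 69 i = true) = {0, 2, 6} by decide]
    simp [hu, hl]
  have g4 : img u 8 138 = {q, s, d} := by
    unfold img; rw [show (range 8).filter (fun i => Nat.testBit 138 i = true) = {1, 3, 7} by decide]
    simp [hu, hl]
  have hcore : ∀ x ∈ coreA, PP H u 8 x := by
    intro x hx
    simp only [coreA, List.mem_cons, List.not_mem_nil, or_false] at hx
    rcases hx with rfl | rfl | rfl | rfl
    · exact ⟨by norm_num, by rw [g1]; exact he1⟩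
    · exact ⟨by norm_num, by rw [g2]; exact hf1⟩
    · exact ⟨by norm_num, by rw [g3]; exact he2⟩
    · exact ⟨by norm_num, by rw [g4]; exact hf2⟩
  have hsub : (range 8).image u ⊆ V := by
    rw [hC]
    intro x hx
    have t1 := (hH _ he1).1
    have t2 := (hH _ hf1).1
    have t3 := (hH _ he2).1
    have t4 := (hH _ hf2).1
    simp only [insert_subset_iff, singleton_subset_iff] at t1 t2 t3 t4
    simp only [mem_insert, mem_singleton] at hx
    rcases hx with rfl | rfl | rfl | rfl | rfl | rfl | rfl | rfl <;> tauto
  have his : ∀ i ∈ [0, 1, 2, 3], i < 8 ∧ spOK coreA 8 i := by decide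
  have hmap : [0, 1, 2, 3].map (2 ^ ·) = [1, 2, 4, 8] := by decide
  rcases Nat.eq_or_lt_of_le hn with h8 | h8
  · have hVe : V = (range 8).image u := by
      symm
      apply eq_of_subset_of_card_le hsub
      rw [card_image_of_injOn, card_range, hV, ← h8]
      intro i hi j hj h
      exact hinj i (by simpa using hi) j (by simpa using hj) h
    have := core_case0 hH h1 h3 hinj hcore rfl hVe his (by norm_num) okA0 covA0 (b := 17) (k := 200)
      (by rw [hmap]; exact goA0)
    rcases this with h | h
    · left; omega
    · exact Or.inr h
  · refine core_case hV hH h1 h3 hinj hcore rfl hsub his (by norm_num) (by norm_num) (by omega) (b := 21)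
      (by norm_num) ?_ okA1 covA1 (k := 200) (by rw [hmap]; exact goA1) okA2 covA2 (k' := 200)
      (by rw [hmap]; exact goA2) (by rw [hmap]; exact f3A)
    apply hside <;> rw [hC] <;> intro x <;> simp only [mem_insert, mem_singleton] <;> tauto

theorem case_beta {V : Finset ℕ} {H : Finset (Finset ℕ)} {n : ℕ} (hn : 8 ≤ n) (hV : V.card = n)
    (hH : ThreeGraphOn V H) (h1 : D1 H) (h3 : D3 H) {p q r s a b d : ℕ}
    (hnd : [p, q, r, s, a, b, d].Nodup) (he1 : {p, q, a} ∈ H) (hf1 : {r, s, b} ∈ H) (he2 : {p, r, a} ∈ H)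
    (hf2 : {q, s, d} ∈ H)
    (hside : ∀ C : Finset ℕ, {p, q, a} ⊆ C → {r, s, b} ⊆ C → {p, r, a} ⊆ C → {q, s, d} ⊆ C → ∀ g ∈ H, 
      g ⊆ C ∨ ∃ w ∈ V \ C, w ∈ g ∧ g ⊆ insert w C) :
    H.card ≤ 4 * n - 11 ∨ SubSP V H := by
  set l := [p, q, r, s, a, b, d] with hl
  set u : ℕ → ℕ := fun i => l.getD i 0 with hu
  have hinj : InjR u 7 := injR_of_nodup hnd
  have hC : (range 7).image u = {p, q, r, s, a, b, d} := by
    rw [show range 7 = {0, 1, 2, 3, 4, 5, 6} by decide]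
    simp [hu, hl]
  have g1 : img u 7 19 = {p, q, a} := by
    unfold img; rw [show (range 7).filter (fun i => Nat.testBit 19 i = true) = {0, 1, 4} by decide]
    simp [hu, hl]
  have g2 : img u 7 44 = {r, s, b} := by
    unfold img; rw [show (range 7).filter (fun i => Nat.testBit 44 i = true) = {2, 3, 5} by decide]
    simp [hu, hl]
  have g3 : img u 7 21 = {p, r, a} := by
    unfold img; rw [show (range 7).filter (fun i => Nat.testBit 21 i = true) = {0, 2, 4} by decide]
    simp [hu, hl]
  have g4 : img u 7 74 = {q, s, d} := by
    unfold img; rw [show (range 7).filter (fun i => Nat.testBit 74 i = true) = {1, 3, 6} by decide]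
    simp [hu, hl]
  have hcore : ∀ x ∈ coreB, PP H u 7 x := by
    intro x hx
    simp only [coreB, List.mem_cons, List.not_mem_nil, or_false] at hx
    rcases hx with rfl | rfl | rfl | rfl
    · exact ⟨by norm_num, by rw [g1]; exact he1⟩
    · exact ⟨by norm_num, by rw [g2]; exact hf1⟩
    · exact ⟨by norm_num, by rw [g3]; exact he2⟩
    · exact ⟨by norm_num, by rw [g4]; exact hf2⟩
  have hsub : (range 7).image u ⊆ V := by
    rw [hC]
    intro x hx
    have t1 := (hH _ he1).1
    have t2 := (hH _ hf1).1
    have t4 := (hH _ hf2).1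
    simp only [insert_subset_iff, singleton_subset_iff] at t1 t2 t4
    simp only [mem_insert, mem_singleton] at hx
    rcases hx with rfl | rfl | rfl | rfl | rfl | rfl | rfl <;> tauto
  have his : ∀ i ∈ [0, 4, 2, 1], i < 7 ∧ spOK coreB 7 i := by decide
  have hmap : [0, 4, 2, 1].map (2 ^ ·) = [1, 16, 4, 2] := by decide
  refine core_case hV hH h1 h3 hinj hcore rfl hsub his (by norm_num) (by norm_num) (by omega) (b := 17)
      (by norm_num) ?_ okB1 covB1 (k := 200) (by rw [hmap]; exact goB1) okB2 covB2 (k' := 200)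
      (by rw [hmap]; exact goB2) (by rw [hmap]; exact f3B)
  apply hside <;> rw [hC] <;> intro x <;> simp only [mem_insert, mem_singleton] <;> tauto

theorem case_M {V : Finset ℕ} {H : Finset (Finset ℕ)} {n : ℕ} (hn : 8 ≤ n) (hV : V.card = n)
    (hH : ThreeGraphOn V H) (h1 : D1 H) (h3 : D3 H)
    {e1 f1 e2 f2 : Finset ℕ} (he1 : e1 ∈ H) (hf1 : f1 ∈ H) (he2 : e2 ∈ H) (hf2 : f2 ∈ H)
    (d1 : e1 ∩ f1 = ∅) (d2 : e2 ∩ f2 = ∅) (x11 : e1 ∩ e2 ≠ ∅) (x12 : e1 ∩ f2 ≠ ∅) (x21 : f1 ∩ e2 ≠ ∅)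
    (x22 : f1 ∩ f2 ≠ ∅) : H.card ≤ 4 * n - 11 ∨ SubSP V H := by
  have hside := fun C c1 c2 c3 c4 => side_of (C := C) hH h1 he1 hf1 he2 hf2 d1 d2 x11 x12 x21 x22 c1 c2 c3 c4
  obtain ⟨p, hp⟩ := nonempty_iff_ne_empty.2 x11
  obtain ⟨q, hq⟩ := nonempty_iff_ne_empty.2 x12
  obtain ⟨r, hr⟩ := nonempty_iff_ne_empty.2 x21
  obtain ⟨s, hs⟩ := nonempty_iff_ne_empty.2 x22
  rw [mem_inter] at hp hq hr hs
  obtain ⟨a, ha, E1⟩ := tri_pair (hH e1 he1).2 hp.1 hq.1 (ne_of_inter d2 hp.2 hq.2) (Subset.refl _)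
  obtain ⟨b, hb, F1⟩ := tri_pair (hH f1 hf1).2 hr.1 hs.1 (ne_of_inter d2 hr.2 hs.2) (Subset.refl _)
  obtain ⟨c, hc, E2⟩ := tri_pair (hH e2 he2).2 hp.2 hr.2 (ne_of_inter d1 hp.1 hr.1) (Subset.refl _)
  obtain ⟨d, hd, F2⟩ := tri_pair (hH f2 hf2).2 hq.2 hs.2 (ne_of_inter d1 hq.1 hs.1) (Subset.refl _)
  have n3 : ∀ x ∈ e1, ∀ y ∈ f1, x ≠ y := fun x hx y hy => ne_of_inter d1 hx hy
  have n4 : ∀ x ∈ e2, ∀ y ∈ f2, x ≠ y := fun x hx y hy => ne_of_inter d2 hx hy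
  have hno : e1 ∪ f1 ≠ e2 ∪ f2 := by
    intro h
    rcases h3 e1 he1 f1 hf1 e2 he2 f2 hf2 d1 d2 h with h | h
    · rw [h] at x12; exact x12 d2
    · rw [h, inter_comm] at x11; exact x11 d2
  simp only [mem_sdiff, mem_insert, mem_singleton, not_or] at ha hb hc hd
  clear x11 x12 x21 x22 d1 d2
  subst E1 F1 E2 F2
  simp only [mem_insert, mem_singleton, forall_eq_or_imp, forall_eq] at n3 n4
  have comm : ∀ x y z : ℕ, ({x, y, z} : Finset ℕ) = {y, x, z} := by intro x y z; ext; simp; tauto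
  by_cases hac : a = c
  · subst hac
    refine case_beta hn hV hH h1 h3 (p := p) (q := q) (r := r) (s := s) (a := a) (b := b) (d := d) ?_ he1 hf1 he2 hf2 hside
    have hbd : b ≠ d := by
      rintro rfl; apply hno; ext; simp; grind
    simp; grind
  by_cases had : a = d
  · subst had
    rw [comm p q a] at *
    rw [comm r s b] at *
    refine case_beta hn hV hH h1 h3 (p := q) (q := p) (r := s) (s := r) (a := a) (b := b) (d := c) ?_ he1 hf1 hf2 he2
      (fun C c1 c2 c3 c4 => hside C c1 c2 c4 c3)
    have hbd : b ≠ c := by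
      rintro rfl; apply hno; ext; simp; grind
    simp; grind
  by_cases hbc : b = c
  · subst hbc
    rw [comm p r b] at *
    rw [comm q s d] at *
    refine case_beta hn hV hH h1 h3 (p := r) (q := s) (r := p) (s := q) (a := b) (b := a) (d := d) ?_ hf1 he1 he2 hf2
      (fun C c1 c2 c3 c4 => hside C c2 c1 c3 c4)
    simp; grind
  by_cases hbd : b = d
  · subst hbd
    rw [comm p q a] at *
    rw [comm r s b] at *
    rw [comm p r c] at *
    rw [comm q s b] at *
    refine case_beta hn hV hH h1 h3 (p := s) (q := r) (r := q) (s := p) (a := b) (b := a) (d := c) ?_ hf1 he1 hf2 he2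
      (fun C c1 c2 c3 c4 => hside C c2 c1 c4 c3)
    simp; grind
  refine case_alpha hn hV hH h1 h3 ?_ he1 hf1 he2 hf2 hside
  simp; grind


theorem pair_count' {F : Finset (Finset ℕ)} {U : Finset ℕ} {a b : ℕ} (hab : a ≠ b)
    (hF : ∀ e ∈ F, e.card = 3 ∧ e ⊆ U ∧ a ∈ e ∧ b ∈ e) : F.card ≤ U.card - 2 := by
  rcases F.eq_empty_or_nonempty with rfl | ⟨e, he⟩
  · simp
  · obtain ⟨_, h1, h2, h3⟩ := hF e he
    exact pair_count hab (h1 h2) (h1 h3) hF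

theorem hit_count {G : Finset (Finset ℕ)} {g : Finset ℕ} {k : ℕ} (h1 : ∀ f ∈ G, (f ∩ g).Nonempty)
    (h2 : ∀ z ∈ g, (G.filter (fun f => z ∈ f)).card ≤ k) : G.card ≤ g.card * k := by
  have : G ⊆ g.biUnion (fun z => G.filter (fun f => z ∈ f)) := by
    intro f hf
    obtain ⟨z, hz⟩ := h1 f hf
    rw [mem_inter] at hz
    rw [mem_biUnion]
    exact ⟨z, hz.2, mem_filter.2 ⟨hf, hz.1⟩⟩
  exact (card_le_card this).trans (card_biUnion_le_card_mul _ _ _ h2)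

theorem tri_eq {f : Finset ℕ} (hf : f.card = 3) {p q z : ℕ} (hp : p ∈ f) (hq : q ∈ f) (hz : z ∈ f)
    (h1 : p ≠ q) (h2 : p ≠ z) (h3 : q ≠ z) : f = {p, q, z} := by
  symm
  apply eq_of_subset_of_card_le
  · intro x; simp only [mem_insert, mem_singleton]; rintro (rfl | rfl | rfl) <;> assumption
  · rw [hf, card_eq_three.2 ⟨p, q, z, h1, h2, h3, rfl⟩]

theorem uniq_count {G : Finset (Finset ℕ)} {p q z : ℕ} (h1 : p ≠ q) (h2 : p ≠ z) (h3 : q ≠ z)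
    (h : ∀ f ∈ G, f.card = 3 ∧ p ∈ f ∧ q ∈ f ∧ z ∈ f) : G.card ≤ 1 := by
  rw [card_le_one]
  intro f hf f' hf'
  obtain ⟨a1, a2, a3, a4⟩ := h f hf
  obtain ⟨b1, b2, b3, b4⟩ := h f' hf'
  rw [tri_eq a1 a2 a3 a4 h1 h2 h3, tri_eq b1 b2 b3 b4 h1 h2 h3]

theorem star_count {F : Finset (Finset ℕ)} {U : Finset ℕ} {y : ℕ}
    (hF : ∀ e ∈ F, e.card = 3 ∧ e ⊆ U ∧ y ∈ e) : F.card ≤ (U.card - 1).choose 2 := by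
  rcases F.eq_empty_or_nonempty with rfl | ⟨e, he⟩
  · simp
  have hy : y ∈ U := (hF e he).2.1 (hF e he).2.2
  have : F ⊆ ((U.erase y).powersetCard 2).image (insert y) := by
    intro f hf
    obtain ⟨h1, h2, h3⟩ := hF f hf
    rw [mem_image]
    refine ⟨f.erase y, ?_, insert_erase h3⟩
    rw [mem_powersetCard, card_erase_of_mem h3, h1]
    exact ⟨erase_subset_erase _ h2, rfl⟩
  refine (card_le_card this).trans (card_image_le.trans ?_)
  rw [card_powersetCard, card_erase_of_mem hy]

theorem four_of_two {F : Finset (Finset ℕ)} {U : Finset ℕ} (hF : ∀ e ∈ F, e.card = 3 ∧ e ⊆ U)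
    (h : 2 ≤ F.card) : 4 ≤ U.card := by
  by_contra hc
  have : F.card ≤ 1 := by
    rw [card_le_one]
    have : ∀ f ∈ F, f = U := fun f hf => eq_of_subset_of_card_le (hF f hf).2 (by rw [(hF f hf).1]; omega)
    intro f hf f' hf'
    rw [this f hf, this f' hf']
  omega

/-- pairwise sharing a vertex besides `v`. -/
theorem link_star {G : Finset (Finset ℕ)} {v : ℕ} (h3 : ∀ e ∈ G, e.card = 3 ∧ v ∈ e) (h4 : 4 ≤ G.card)
    (hs : ∀ e ∈ G, ∀ f ∈ G, ∃ z, z ≠ v ∧ z ∈ e ∧ z ∈ f) : ∃ a, a ≠ v ∧ ∀ e ∈ G, a ∈ e := by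
  by_contra hc
  push Not at hc
  obtain ⟨e1, he1⟩ : G.Nonempty := card_pos.1 (by omega)
  obtain ⟨a, hav, ha, -⟩ := hs e1 he1 e1 he1
  obtain ⟨e2, he2, ha2⟩ := hc a hav
  obtain ⟨b, hbv, hb1, hb2⟩ := hs e1 he1 e2 he2
  have hab : a ≠ b := by rintro rfl; exact ha2 hb2
  obtain ⟨e3, he3, hb3⟩ := hc b hbv
  obtain ⟨x, hxv, hx2, hx3⟩ := hs e2 he2 e3 he3
  have hxb : x ≠ b := by rintro rfl; exact hb3 hx3
  have hxa : x ≠ a := by rintro rfl; exact ha2 hx2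
  have E1 := tri_eq (h3 e1 he1).1 (h3 e1 he1).2 ha hb1 hav.symm hbv.symm hab
  have E2 := tri_eq (h3 e2 he2).1 (h3 e2 he2).2 hb2 hx2 hbv.symm hxv.symm hxb.symm
  obtain ⟨a', hav', ha1, ha3⟩ := hs e1 he1 e3 he3
  have : a' = a := by
    rw [E1] at ha1; simp only [mem_insert, mem_singleton] at ha1
    rcases ha1 with h | h | h
    · exact absurd h hav'
    · exact h
    · rw [h] at ha3; exact absurd ha3 hb3
  subst this
  have E3 := tri_eq (h3 e3 he3).1 (h3 e3 he3).2 ha3 hx3 hav.symm hxv.symm hxa.symm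
  have hsub : G ⊆ {{v, a', b}, {v, b, x}, {v, a', x}} := by
    intro f hf
    obtain ⟨z1, z1v, z1e, z1f⟩ := hs e1 he1 f hf
    obtain ⟨z2, z2v, z2e, z2f⟩ := hs e2 he2 f hf
    obtain ⟨z3, z3v, z3e, z3f⟩ := hs e3 he3 f hf
    have key : ∀ p q, p ∈ f → q ∈ f → p ≠ v → q ≠ v → p ≠ q → f = {v, p, q} := fun p q hp hq h1 h2 h3' =>
      tri_eq (h3 f hf).1 (h3 f hf).2 hp hq h1.symm h2.symm h3'
    rw [E1] at z1e; rw [E2] at z2e; rw [E3] at z3e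
    simp only [mem_insert, mem_singleton] at z1e z2e z3e ⊢
    have k1 : a' ∈ f ∨ b ∈ f := by rcases z1e with h | h | h <;> subst h <;> tauto
    have k2 : b ∈ f ∨ x ∈ f := by rcases z2e with h | h | h <;> subst h <;> tauto
    have k3 : a' ∈ f ∨ x ∈ f := by rcases z3e with h | h | h <;> subst h <;> tauto
    by_cases hfa : a' ∈ f
    · rcases k2 with h | h
      · exact Or.inl (key _ _ hfa h hav hbv hab)
      · exact Or.inr (Or.inr (key _ _ hfa h hav hxv hxa.symm))
    · exact Or.inr (Or.inl (key _ _ (k1.resolve_left hfa) (k3.resolve_left hfa) hbv hxv hxb.symm))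
  have := (card_le_card hsub).trans card_le_three
  omega

def IntF (F : Finset (Finset ℕ)) : Prop := ∀ e ∈ F, ∀ f ∈ F, (e ∩ f).Nonempty

theorem hm2_aux {F : Finset (Finset ℕ)} {U : Finset ℕ} {u v : ℕ} (huv : u ≠ v) (hv : v ∈ U)
    (hF : ∀ e ∈ F, e.card = 3 ∧ e ⊆ U) (hi : IntF F) (hno : ∃ e ∈ F, u ∉ e) 
    (hcov : ∀ e ∈ F, u ∈ e ∨ v ∈ e) : 4 ≤ U.card ∧ (F.filter (fun e => u ∈ e ∧ v ∉ e)).card ≤ 2 * U.card - 7 ∨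
      (F.filter (fun e => u ∈ e ∧ v ∉ e)) = ∅ := by
  obtain ⟨f0, hf0, huf0⟩ := hno
  have hvf0 := (hcov f0 hf0).resolve_left huf0
  obtain ⟨g, h, hgh, hfe⟩ := card_eq_two.1
    (show (f0.erase v).card = 2 by rw [card_erase_of_mem hvf0, (hF f0 hf0).1])
  have hg : g ∈ f0.erase v := by rw [hfe]; simp
  have hh : h ∈ f0.erase v := by rw [hfe]; simp
  rw [mem_erase] at hg hh
  have hug : u ≠ g := by rintro rfl; exact huf0 hg.2
  have huh : u ≠ h := by rintro rfl; exact huf0 hh.2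
  set G := F.filter (fun e => u ∈ e ∧ v ∉ e) with hG
  rcases G.eq_empty_or_nonempty with h0 | ⟨e0, he0⟩
  · exact Or.inr h0
  left
  have huU : u ∈ U := (hF e0 (mem_filter.1 he0).1).2 (mem_filter.1 he0).2.1
  have hgU := (hF f0 hf0).2 hg.2
  have hhU := (hF f0 hf0).2 hh.2
  have h4 : 4 ≤ U.card := by
    have : ({u, v, g, h} : Finset ℕ) ⊆ U := by
      intro x; simp only [mem_insert, mem_singleton]; rintro (rfl | rfl | rfl | rfl) <;> assumption
    have h5 := card_le_card this
    rwa [card_insert_of_notMem, card_eq_three.2 ⟨v, g, h, hg.1.symm, hh.1.symm, hgh, rfl⟩] at h5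
    simp; tauto
  refine ⟨h4, ?_⟩
  have hsub : G ⊆ G.filter (fun e => g ∈ e) ∪ G.filter (fun e => h ∈ e ∧ g ∉ e) := by
    intro e he
    have he' := mem_filter.1 he
    obtain ⟨z, hz⟩ := hi e he'.1 f0 hf0
    rw [mem_inter] at hz
    have hzz : z ∈ f0.erase v := mem_erase.2 ⟨fun h => he'.2.2 (h ▸ hz.1), hz.2⟩
    rw [hfe] at hzz
    simp only [mem_insert, mem_singleton] at hzz
    rw [mem_union]
    by_cases hge : g ∈ e
    · exact Or.inl (mem_filter.2 ⟨he, hge⟩)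
    · rcases hzz with rfl | rfl
      · exact absurd hz.1 hge
      · exact Or.inr (mem_filter.2 ⟨he, hz.1, hge⟩)
  have c1 : (G.filter (fun e => g ∈ e)).card ≤ (U.erase v).card - 2 := by
    apply pair_count' hug
    intro e he
    rw [mem_filter, mem_filter] at he
    exact ⟨(hF e he.1.1).1, subset_erase.2 ⟨(hF e he.1.1).2, he.1.2.2⟩, he.1.2.1, he.2⟩
  have c2 : (G.filter (fun e => h ∈ e ∧ g ∉ e)).card ≤ ((U.erase v).erase g).card - 2 := by
    apply pair_count' huh
    intro e he
    rw [mem_filter, mem_filter] at he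
    exact ⟨(hF e he.1.1).1, subset_erase.2 ⟨subset_erase.2 ⟨(hF e he.1.1).2, he.1.2.2⟩, he.2.2⟩, he.1.2.1, he.2.1⟩
  rw [card_erase_of_mem hv] at c1
  rw [card_erase_of_mem (mem_erase.2 ⟨hg.1, hgU⟩), card_erase_of_mem hv] at c2
  have := (card_le_card hsub).trans (card_union_le _ _)
  omega

/-- either the link at `v` is a star or `F_u` is small -/
theorem hm2_link {F : Finset (Finset ℕ)} {U : Finset ℕ} {u v : ℕ} (huv : u ≠ v) (huU : u ∈ U)
    (hF : ∀ e ∈ F, e.card = 3 ∧ e ⊆ U) (hi : IntF F) :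
    (F.filter (fun e => u ∈ e ∧ v ∉ e)).card ≤ 4 ∨ (F.filter (fun e => v ∈ e ∧ u ∉ e)).card ≤ 3 ∨
    (F.filter (fun e => v ∈ e ∧ u ∉ e)).card ≤ U.card - 3 := by
  set G := F.filter (fun e => v ∈ e ∧ u ∉ e) with hG
  have hGm : ∀ e ∈ G, e ∈ F ∧ v ∈ e ∧ u ∉ e := fun e he => mem_filter.1 he
  by_cases h4 : 4 ≤ G.card
  · by_cases hs : ∀ e ∈ G, ∀ f ∈ G, ∃ z, z ≠ v ∧ z ∈ e ∧ z ∈ f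
    · obtain ⟨a, hav, ha⟩ := link_star (fun e he => ⟨(hF e (hGm e he).1).1, (hGm e he).2.1⟩) h4 hs
      right; right
      have : G.card ≤ (U.erase u).card - 2 := by
        apply pair_count' hav
        intro e he
        obtain ⟨h1, h2, h3⟩ := hGm e he
        exact ⟨(hF e h1).1, subset_erase.2 ⟨(hF e h1).2, h3⟩, ha e he, h2⟩
      rw [card_erase_of_mem huU] at this
      omega
    · left
      push Not at hs
      obtain ⟨e, he, f, hf, hef⟩ := hs
      obtain ⟨e1, e2, e3⟩ := hGm e he
      obtain ⟨f1, f2, f3⟩ := hGm f hf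
      have : (F.filter (fun e => u ∈ e ∧ v ∉ e)).card ≤ (e.erase v).card * ((f.erase v).card * 1) := by
        apply hit_count
        · intro g hg
          rw [mem_filter] at hg
          obtain ⟨z, hz⟩ := hi g hg.1 e e1
          rw [mem_inter] at hz
          exact ⟨z, mem_inter.2 ⟨hz.1, mem_erase.2 ⟨fun h => hg.2.2 (h ▸ hz.1), hz.2⟩⟩⟩
        · intro z hz
          rw [mem_erase] at hz
          apply hit_count
          · intro g hg
            rw [mem_filter, mem_filter] at hg
            obtain ⟨z', hz'⟩ := hi g hg.1.1 f f1
            rw [mem_inter] at hz'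
            exact ⟨z', mem_inter.2 ⟨hz'.1, mem_erase.2 ⟨fun h => hg.1.2.2 (h ▸ hz'.1), hz'.2⟩⟩⟩
          · intro z' hz'
            rw [mem_erase] at hz'
            apply uniq_count (p := u) (q := z) (z := z')
            · rintro rfl; exact e3 hz.2
            · rintro rfl; exact f3 hz'.2
            · rintro rfl; exact hef z hz.1 hz.2 hz'.2
            · intro g hg
              rw [mem_filter, mem_filter, mem_filter] at hg
              exact ⟨(hF g hg.1.1.1).1, hg.1.1.2.1, hg.1.2, hg.2⟩
      rw [card_erase_of_mem e2, card_erase_of_mem f2, (hF e e1).1, (hF f f1).1] at this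
      exact this
  · right; left; omega

theorem hm2 {F : Finset (Finset ℕ)} {U : Finset ℕ} {u v : ℕ} (huv : u ≠ v) (hu : u ∈ U) (hv : v ∈ U)
    (hF : ∀ e ∈ F, e.card = 3 ∧ e ⊆ U) (hi : IntF F) (hno : ∀ x, ∃ e ∈ F, x ∉ e)
    (hcov : ∀ e ∈ F, u ∈ e ∨ v ∈ e) : F.card ≤ 3 * U.card - 5 := by
  have a1 := hm2_aux huv hv hF hi (hno u) hcov
  have a2 := hm2_aux huv.symm hu hF hi (hno v) (fun e he => (hcov e he).symm)
  have b1 := hm2_link huv hu hF hi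
  have b2 := hm2_link huv.symm hv hF hi
  have c0 : (F.filter (fun e => u ∈ e ∧ v ∈ e)).card ≤ U.card - 2 := by
    apply pair_count' huv
    intro e he
    rw [mem_filter] at he
    exact ⟨(hF e he.1).1, (hF e he.1).2, he.2.1, he.2.2⟩
  have hsub : F ⊆ F.filter (fun e => u ∈ e ∧ v ∈ e) ∪ (F.filter (fun e => u ∈ e ∧ v ∉ e) ∪
      F.filter (fun e => v ∈ e ∧ u ∉ e)) := by
    intro e he
    have := hcov e he
    simp only [mem_union, mem_filter, he, true_and]
    tauto
  have hc := (card_le_card hsub).trans ((card_union_le _ _).trans (Nat.add_le_add_left (card_union_le _ _) _))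
  obtain ⟨e, he, hue⟩ := hno u
  obtain ⟨f, hf, hvf⟩ := hno v
  have n1 : (F.filter (fun e => u ∈ e ∧ v ∉ e)) ≠ ∅ := by
    rw [← nonempty_iff_ne_empty]
    exact ⟨f, mem_filter.2 ⟨hf, (hcov f hf).resolve_right hvf, hvf⟩⟩
  have n2 : (F.filter (fun e => v ∈ e ∧ u ∉ e)) ≠ ∅ := by
    rw [← nonempty_iff_ne_empty]
    exact ⟨e, mem_filter.2 ⟨he, (hcov e he).resolve_left hue, hue⟩⟩
  have a1' := a1.resolve_right n1
  have a2' := a2.resolve_right n2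
  omega


theorem codeg3 {F : Finset (Finset ℕ)} (hF : ∀ e ∈ F, e.card = 3) (hi : IntF F)
    (hno : ∀ u v, ∃ e ∈ F, u ∉ e ∧ v ∉ e) {p q : ℕ} (hpq : p ≠ q) :
    (F.filter (fun h => p ∈ h ∧ q ∈ h)).card ≤ 3 := by
  obtain ⟨k, hk, hpk, hqk⟩ := hno p q
  have := hit_count (G := F.filter (fun h => p ∈ h ∧ q ∈ h)) (g := k) (k := 1)
    (fun f hf => hi f (mem_filter.1 hf).1 k hk) (by
      intro z hz
      apply uniq_count (p := p) (q := q) (z := z) hpq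
      · rintro rfl; exact hpk hz
      · rintro rfl; exact hqk hz
      · intro f hf
        rw [mem_filter, mem_filter] at hf
        exact ⟨hF f hf.1.1, hf.1.2.1, hf.1.2.2, hf.2⟩)
  rw [hF k hk] at this
  exact this

theorem hm3_aux (A B U V W E F : Prop) (k1 : A ∨ B ∨ U) (k2 : A ∨ B ∨ V) (k3 : U ∨ V ∨ W) :
    (E ∨ F) ∨ (¬E ∧ A ∧ U) ∨ (¬E ∧ B ∧ U) ∨ (¬F ∧ A ∧ V) ∨ (¬F ∧ B ∧ V) ∨ (A ∧ W) ∨ (B ∧ W) ∨ (U ∧ V) := by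
  by_cases E <;> by_cases F <;> simp_all <;> by_cases A <;> simp_all <;> by_cases B <;> simp_all <;> tauto

theorem hm3 {F : Finset (Finset ℕ)} (hF : ∀ e ∈ F, e.card = 3) (hi : IntF F)
    (hno : ∀ u v, ∃ e ∈ F, u ∉ e ∧ v ∉ e) : F.card ≤ 19 := by
  by_cases h2 : ∃ e ∈ F, ∃ f ∈ F, ∃ a b, a ≠ b ∧ a ∈ e ∧ b ∈ e ∧ a ∈ f ∧ b ∈ f ∧ e ≠ f
  · obtain ⟨e, he, f, hf, a, b, hab, ae, be, af, bf, hef⟩ := h2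
    obtain ⟨g, hg, ag, bg⟩ := hno a b
    obtain ⟨u, hu⟩ := hi e he g hg
    obtain ⟨v, hv⟩ := hi f hf g hg
    rw [mem_inter] at hu hv
    have au : a ≠ u := by rintro rfl; exact ag hu.2
    have bu : b ≠ u := by rintro rfl; exact bg hu.2
    have av : a ≠ v := by rintro rfl; exact ag hv.2
    have bv : b ≠ v := by rintro rfl; exact bg hv.2
    have E := tri_eq (hF e he) ae be hu.1 hab au bu
    have Fe := tri_eq (hF f hf) af bf hv.1 hab av bv
    have uv : u ≠ v := by rintro rfl; exact hef (E.trans Fe.symm)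
    obtain ⟨w, hw, hgw⟩ := tri_pair (hF g hg) hu.2 hv.2 uv (Subset.refl g)
    have wg : w ∈ g := (mem_sdiff.1 hw).1
    have aw : a ≠ w := by rintro rfl; exact ag wg
    have bw : b ≠ w := by rintro rfl; exact bg wg
    let P : ℕ → ℕ → Finset (Finset ℕ) := fun p q => F.filter (fun h => p ∈ h ∧ q ∈ h)
    have hP : ∀ p q, p ≠ q → (P p q).card ≤ 3 := fun p q h => codeg3 hF hi hno h
    have hP2 : ∀ p q k, p ≠ q → k ∈ F → p ∈ k → q ∈ k → ((P p q).erase k).card ≤ 2 := by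
      intro p q k hpq hk hp hq
      rw [card_erase_of_mem (mem_filter.2 ⟨hk, hp, hq⟩)]
      have := hP p q hpq
      simp only [P] at this
      omega
    have c1 := hP2 a u e au he ae hu.1
    have c2 := hP2 b u e bu he be hu.1
    have c3 := hP2 a v f av hf af hv.1
    have c4 := hP2 b v f bv hf bf hv.1
    have c5 := hP a w aw
    have c6 := hP b w bw
    have c7 := hP u v uv
    have c0 : ({e, f} : Finset (Finset ℕ)).card ≤ 2 := card_le_two
    have hsub : F ⊆ {e, f} ∪ ((P a u).erase e ∪ ((P b u).erase e ∪ ((P a v).erase f ∪ ((P b v).erase f ∪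
        (P a w ∪ (P b w ∪ P u v)))))) := by
      intro h hh
      obtain ⟨z1, hz1⟩ := hi h hh e he
      obtain ⟨z2, hz2⟩ := hi h hh f hf
      obtain ⟨z3, hz3⟩ := hi h hh g hg
      rw [mem_inter] at hz1 hz2 hz3
      obtain ⟨z1h, z1e⟩ := hz1
      obtain ⟨z2h, z2e⟩ := hz2
      obtain ⟨z3h, z3e⟩ := hz3
      have k1 : a ∈ h ∨ b ∈ h ∨ u ∈ h := by
        rw [E] at z1e; simp only [mem_insert, mem_singleton] at z1e
        rcases z1e with rfl | rfl | rfl <;> tauto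
      have k2 : a ∈ h ∨ b ∈ h ∨ v ∈ h := by
        rw [Fe] at z2e; simp only [mem_insert, mem_singleton] at z2e
        rcases z2e with rfl | rfl | rfl <;> tauto
      have k3 : u ∈ h ∨ v ∈ h ∨ w ∈ h := by
        rw [hgw] at z3e; simp only [mem_insert, mem_singleton] at z3e
        rcases z3e with rfl | rfl | rfl <;> tauto
      simp only [P, mem_union, mem_insert, mem_singleton, mem_erase, mem_filter, hh, true_and, Ne]
      exact hm3_aux _ _ _ _ _ _ _ k1 k2 k3
    have t := card_le_card hsub
    have t1 := card_union_le {e, f} ((P a u).erase e ∪ ((P b u).erase e ∪ ((P a v).erase f ∪ ((P b v).erase f ∪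
        (P a w ∪ (P b w ∪ P u v))))))
    have t2 := card_union_le ((P a u).erase e) ((P b u).erase e ∪ ((P a v).erase f ∪ ((P b v).erase f ∪
        (P a w ∪ (P b w ∪ P u v)))))
    have t3 := card_union_le ((P b u).erase e) ((P a v).erase f ∪ ((P b v).erase f ∪
        (P a w ∪ (P b w ∪ P u v))))
    have t4 := card_union_le ((P a v).erase f) ((P b v).erase f ∪ (P a w ∪ (P b w ∪ P u v)))
    have t5 := card_union_le ((P b v).erase f) (P a w ∪ (P b w ∪ P u v))
    have t6 := card_union_le (P a w) (P b w ∪ P u v)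
    have t7 := card_union_le (P b w) (P u v)
    omega
  · push Not at h2
    obtain ⟨e, he, -⟩ := hno 0 0
    have : F.card ≤ e.card * (3 * 1) := by
      apply hit_count (fun f hf => hi f hf e he)
      intro z hz
      obtain ⟨k, hk, hzk, -⟩ := hno z z
      rw [← hF k hk]
      apply hit_count (fun f hf => hi f (mem_filter.1 hf).1 k hk)
      intro z' hz'
      rw [card_le_one]
      intro f hf f' hf'
      rw [mem_filter, mem_filter] at hf hf'
      exact h2 f hf.1.1 f' hf'.1.1 z z' (by rintro rfl; exact hzk hz') hf.1.2 hf.2 hf'.1.2 hf'.2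
    rw [hF e he] at this
    omega

theorem hm {F : Finset (Finset ℕ)} {V : Finset ℕ} {n : ℕ} (hn : 8 ≤ n) (hV : V.card = n)
    (hF : ∀ e ∈ F, e.card = 3 ∧ e ⊆ V) (hi : IntF F) (hno : ∀ x, ∃ e ∈ F, x ∉ e) : F.card ≤ 3 * n - 5 := by
  by_cases h : ∀ u v, ∃ e ∈ F, u ∉ e ∧ v ∉ e
  · have := hm3 (fun e he => (hF e he).1) hi h
    omega
  · push Not at h
    obtain ⟨u, v, h⟩ := h
    rw [← hV]
    obtain ⟨e, he, ue⟩ := hno u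
    obtain ⟨f, hf, vf⟩ := hno v
    have ve := h e he ue
    have uf : u ∈ f := by by_contra hc; exact vf (h f hf hc)
    refine hm2 (u := u) (v := v) (by rintro rfl; exact vf uf) ((hF f hf).2 uf) ((hF e he).2 ve) hF hi hno ?_
    intro k hk
    by_cases hu : u ∈ k
    · exact Or.inl hu
    · exact Or.inr (h k hk hu)

theorem starplus_of {V : Finset ℕ} {H : Finset (Finset ℕ)} {v : ℕ} {e : Finset ℕ} (hH : ThreeGraphOn V H)
    (hv : v ∈ V) (he : e ⊆ V) (h3 : e.card = 3) (hve : v ∉ e) (h : ∀ f ∈ H, v ∈ f ∨ f = e) : SubStarPlus V H := by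
  refine ⟨_, ⟨v, hv, e, he, h3, hve, rfl⟩, ?_⟩
  intro f hf
  rw [mem_union, mem_filter, mem_powersetCard, mem_singleton]
  rcases h f hf with h | h
  · exact Or.inl ⟨hH f hf, h⟩
  · exact Or.inr h

theorem case_O0 {V : Finset ℕ} {H : Finset (Finset ℕ)} {n : ℕ} (hn : 8 ≤ n) (hV : V.card = n)
    (hH : ThreeGraphOn V H) (hi : IntF H) : SubStarPlus V H ∨ H.card ≤ 4 * n - 11 := by
  by_cases hno : ∀ x, ∃ e ∈ H, x ∉ e
  · right
    have := hm hn hV (fun e he => ⟨(hH e he).2, (hH e he).1⟩) hi hno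
    omega
  · left
    push Not at hno
    obtain ⟨x, hx⟩ := hno
    have : ∃ v ∈ V, ∀ e ∈ H, v ∈ e := by
      rcases H.eq_empty_or_nonempty with rfl | ⟨e, he⟩
      · obtain ⟨v, hv⟩ : V.Nonempty := card_pos.1 (by omega)
        exact ⟨v, hv, by simp⟩
      · exact ⟨x, (hH e he).1 (hx e he), hx⟩
    obtain ⟨v, hv, h⟩ := this
    obtain ⟨e, he, h3⟩ := exists_subset_card_eq (s := V.erase v) (n := 3) (by rw [card_erase_of_mem hv]; omega)
    exact starplus_of hH hv (he.trans (erase_subset _ _)) h3 (fun h => by simpa using he h) (fun f hf => Or.inl (h f hf))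


theorem ch2 (a b : ℕ) : 2 * (a + b).choose 2 = 2 * a.choose 2 + 2 * (a * b) + 2 * b.choose 2 := by
  induction b with
  | zero => simp
  | succ b ih =>
    rw [← add_assoc, Nat.choose_succ_succ' (a + b) 1, Nat.choose_succ_succ' b 1, Nat.choose_one_right,
      Nat.choose_one_right]
    linarith

theorem ch2' (b : ℕ) : 2 * b.choose 2 + b = b * b := by
  induction b with
  | zero => simp
  | succ b ih =>
    rw [Nat.choose_succ_succ' b 1, Nat.choose_one_right]
    linarith

theorem arith1 {n s t : ℕ} (hs : 5 ≤ s) (ht : 3 ≤ t) (h : s + t ≤ n) :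
    (s - 2) + (t - 1).choose 2 + 2 * (n - 2) ≤ (n - 4).choose 2 + 10 := by
  obtain ⟨j, rfl⟩ := Nat.exists_eq_add_of_le hs
  obtain ⟨m, rfl⟩ : ∃ m, n = m + 6 + j + 2 := ⟨n - 8 - j, by omega⟩
  have hc : (t - 1).choose 2 ≤ (m + 2).choose 2 := Nat.choose_le_choose 2 (by omega)
  have e1 := ch2 (m + 2) (2 + j)
  have e2 := ch2' (2 + j)
  rw [show m + 6 + j + 2 - 4 = m + 2 + (2 + j) by omega]
  have : j * j + 3 ≥ 3 * j := by
    rcases Nat.lt_or_ge j 3 with h | h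
    · interval_cases j <;> omega
    · nlinarith
  have e3 : (5 + j - 2) + 2 * (m + 6 + j + 2 - 2) = 3 * j + 2 * m + 15 := by omega
  nlinarith [Nat.zero_le (j * m), Nat.zero_le (j*j)]

theorem arith2 {n s t : ℕ} (hs : 4 ≤ s) (ht : 4 ≤ t) (h : s + t ≤ n) :
    (3 * s - 5) + (t - 1).choose 2 + 9 ≤ 4 * n - 11 ∨
    (3 * s - 5) + (t - 1).choose 2 + 9 ≤ (n - 4).choose 2 + 10 := by
  obtain ⟨m, rfl⟩ : ∃ m, n = m + s + 4 := ⟨n - s - 4, by omega⟩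
  have hc : (t - 1).choose 2 ≤ (m + 3).choose 2 := Nat.choose_le_choose 2 (by omega)
  rcases Nat.lt_or_ge m 1 with h1 | h1
  · interval_cases m
    have : (0 + 3).choose 2 = 3 := by decide
    omega
  rcases Nat.lt_or_ge s 5 with h2 | h2
  · interval_cases s
    rcases Nat.lt_or_ge m 3 with h3 | h3
    · have a1 : (1 + 3).choose 2 = 6 := by decide
      have a2 : (2 + 3).choose 2 = 10 := by decide
      interval_cases m <;> omega
    · right
      have e1 := ch2 (m + 3) 1
      rw [show m + 4 + 4 - 4 = m + 3 + 1 by omega]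
      have : Nat.choose 1 2 = 0 := by decide
      omega
  · right
    obtain ⟨j, rfl⟩ := Nat.exists_eq_add_of_le h2
    have e1 := ch2 (m + 3) (2 + j)
    have e2 := ch2' (2 + j)
    rw [show m + (5 + j) + 4 - 4 = m + 3 + (2 + j) by omega]
    have e3 : 3 * (5 + j) - 5 = 10 + 3 * j := by omega
    nlinarith [Nat.zero_le (j * j), Nat.mul_le_mul_left j h1]

theorem arith3 {n s t : ℕ} (hs : 4 ≤ s) (ht : 4 ≤ t) (h : s + t ≤ n) :
    (2 * s - 1) + (t - 1).choose 2 + (n - 2) ≤ (n - 4).choose 2 + 10 := by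
  obtain ⟨j, rfl⟩ := Nat.exists_eq_add_of_le hs
  obtain ⟨m, rfl⟩ : ∃ m, n = m + 8 + j := ⟨n - 8 - j, by omega⟩
  have hc : (t - 1).choose 2 ≤ (m + 3).choose 2 := Nat.choose_le_choose 2 (by omega)
  have e1 := ch2 (m + 3) (1 + j)
  have e2 := ch2' (1 + j)
  rw [show m + 8 + j - 4 = m + 3 + (1 + j) by omega]
  have e3 : 2 * (4 + j) - 1 + (m + 8 + j - 2) = 3 * j + m + 13 := by omega
  nlinarith [Nat.zero_le (j * j), Nat.zero_le (j * m)]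

theorem arith4 {n s t : ℕ} (hs : 4 ≤ s) (ht : 4 ≤ t) (h : s + t ≤ n) :
    (s - 1).choose 2 + (t - 1).choose 2 + (n - 2) ≤ (n - 4).choose 2 + 10 := by
  obtain ⟨j, rfl⟩ := Nat.exists_eq_add_of_le hs
  obtain ⟨m, rfl⟩ : ∃ m, n = m + 8 + j := ⟨n - 8 - j, by omega⟩
  have hc : (t - 1).choose 2 ≤ (m + 3).choose 2 := Nat.choose_le_choose 2 (by omega)
  have e1 := ch2 (m + 3) (1 + j)
  have e2 := ch2' (1 + j)
  have e0 := ch2' (3 + j)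
  rw [show m + 8 + j - 4 = m + 3 + (1 + j) by omega, show 4 + j - 1 = 3 + j by omega]
  have e3 : (m + 8 + j - 2) = j + m + 6 := by omega
  nlinarith [Nat.zero_le (j * j), Nat.zero_le (j * m)]

structure OS (V : Finset ℕ) (H A B R : Finset (Finset ℕ)) (n : ℕ) : Prop where
  hn : 8 ≤ n
  hV : V.card = n
  hH : ThreeGraphOn V H
  eq : H = A ∪ B ∪ R
  AB : ∀ a ∈ A, ∀ b ∈ B, a ∩ b = ∅
  Ai : IntF A
  Bi : IntF B
  Ri : IntF R
  AR : ∀ a ∈ A, ∀ r ∈ R, (r ∩ a).Nonempty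
  BR : ∀ b ∈ B, ∀ r ∈ R, (r ∩ b).Nonempty
  An : A.Nonempty
  Bn : B.Nonempty
  Rn : R.Nonempty

namespace OS
variable {V : Finset ℕ} {H A B R : Finset (Finset ℕ)} {n : ℕ}

theorem symm (o : OS V H A B R n) : OS V H B A R n where
  hn := o.hn
  hV := o.hV
  hH := o.hH
  eq := by rw [o.eq, union_comm A B]
  AB := fun b hb a ha => by rw [inter_comm]; exact o.AB a ha b hb
  Ai := o.Bi
  Bi := o.Ai
  Ri := o.Ri
  AR := o.BR
  BR := o.AR
  An := o.Bn
  Bn := o.An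
  Rn := o.Rn

theorem hA (o : OS V H A B R n) {a : Finset ℕ} (h : a ∈ A) : a.card = 3 ∧ a ⊆ V :=
  (o.hH a (by rw [o.eq]; simp [h])).symm
theorem hB (o : OS V H A B R n) {a : Finset ℕ} (h : a ∈ B) : a.card = 3 ∧ a ⊆ V :=
  (o.hH a (by rw [o.eq]; simp [h])).symm
theorem hR (o : OS V H A B R n) {a : Finset ℕ} (h : a ∈ R) : a.card = 3 ∧ a ⊆ V :=
  (o.hH a (by rw [o.eq]; simp [h])).symm

theorem card3 (o : OS V H A B R n) : H.card ≤ A.card + B.card + R.card := by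
  rw [o.eq]
  exact (card_union_le _ _).trans (Nat.add_le_add_right (card_union_le _ _) _)

theorem card2 (o : OS V H A B R n) : H.card ≤ A.card + (B ∪ R).card := by
  rw [o.eq, union_assoc]
  exact card_union_le _ _

theorem subX {F : Finset (Finset ℕ)} {a : Finset ℕ} (h : a ∈ F) : a ⊆ F.biUnion id :=
  subset_biUnion_of_mem id h

theorem st (o : OS V H A B R n) : (A.biUnion id).card + (B.biUnion id).card ≤ n := by
  have hd : Disjoint (A.biUnion id) (B.biUnion id) := by
    rw [disjoint_left]
    intro x hx hy
    simp only [mem_biUnion, id] at hx hy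
    obtain ⟨a, ha, xa⟩ := hx
    obtain ⟨b, hb, xb⟩ := hy
    exact not_mem_of_inter (o.AB a ha b hb) xa xb
  rw [← card_union_of_disjoint hd, ← o.hV]
  apply card_le_card
  intro x hx
  simp only [mem_union, mem_biUnion, id] at hx
  rcases hx with ⟨a, ha, xa⟩ | ⟨a, ha, xa⟩
  · exact (o.hA ha).2 xa
  · exact (o.hB ha).2 xa

theorem s3 (o : OS V H A B R n) : 3 ≤ (A.biUnion id).card := by
  obtain ⟨a, ha⟩ := o.An
  rw [← (o.hA ha).1]
  exact card_le_card (subX ha)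

theorem s4 (o : OS V H A B R n) (h : 2 ≤ A.card) : 4 ≤ (A.biUnion id).card :=
  four_of_two (fun _ he => ⟨(o.hA he).1, subX he⟩) h

theorem intBR (o : OS V H A B R n) : IntF (B ∪ R) := by
  intro e he f hf
  rw [mem_union] at he hf
  rcases he with he | he <;> rcases hf with hf | hf
  · exact o.Bi e he f hf
  · rw [inter_comm]; exact o.BR e he f hf
  · exact o.BR f hf e he
  · exact o.Ri e he f hf

theorem yA (o : OS V H A B R n) {y : ℕ} (hy : ∀ b ∈ B, y ∈ b) {a : Finset ℕ} (ha : a ∈ A) : y ∉ a := by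
  obtain ⟨b, hb⟩ := o.Bn
  exact fun h => not_mem_of_inter (o.AB a ha b hb) h (hy b hb)

/-- `r` containing `y` meets `a` outside `y`. -/
theorem meet (o : OS V H A B R n) {y : ℕ} (hy : ∀ b ∈ B, y ∈ b) {a r : Finset ℕ} (ha : a ∈ A) (hr : r ∈ R) :
    ∃ z, z ∈ r ∧ z ∈ a ∧ z ≠ y := by
  obtain ⟨z, hz⟩ := o.AR a ha r hr
  rw [mem_inter] at hz
  exact ⟨z, hz.1, hz.2, fun h => o.yA hy ha (h ▸ hz.2)⟩

theorem cb_case (o : OS V H A B R n) {x1 x2 y : ℕ} (h12 : x1 ≠ x2) (hx : ∀ a ∈ A, x1 ∈ a ∧ x2 ∈ a)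
    (hyB : ∀ b ∈ B, y ∈ b) (hyR : ∀ r ∈ R, y ∈ r) (h2 : A.card = 2) : SubCB V H := by
  obtain ⟨a1, a2, h12', rfl⟩ := card_eq_two.1 h2
  have ha1 : a1 ∈ ({a1, a2} : Finset (Finset ℕ)) := by simp
  have ha2 : a2 ∈ ({a1, a2} : Finset (Finset ℕ)) := by simp
  obtain ⟨z1, hz1, e1⟩ := tri_pair (o.hA ha1).1 (hx _ ha1).1 (hx _ ha1).2 h12 (Subset.refl _)
  obtain ⟨z2, hz2, e2⟩ := tri_pair (o.hA ha2).1 (hx _ ha2).1 (hx _ ha2).2 h12 (Subset.refl _)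
  simp only [mem_sdiff, mem_insert, mem_singleton, not_or] at hz1 hz2
  have hz : z1 ≠ z2 := by rintro rfl; exact h12' (e1.trans e2.symm)
  have y1 := o.yA hyB ha1
  have y2 := o.yA hyB ha2
  have yx1 : y ≠ x1 := by rintro rfl; exact y1 (hx _ ha1).1
  have yx2 : y ≠ x2 := by rintro rfl; exact y1 (hx _ ha1).2
  have yz1 : y ≠ z1 := by rintro rfl; exact y1 hz1.1
  have yz2 : y ≠ z2 := by rintro rfl; exact y2 hz2.1
  obtain ⟨hz1, hz1x, hz1y⟩ := hz1
  obtain ⟨hz2, hz2x, hz2y⟩ := hz2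
  obtain ⟨r0, hr0⟩ := o.Rn
  refine ⟨_, ⟨y, x1, x2, z1, z2, ?_, ?_, rfl⟩, ?_⟩
  · intro v
    simp only [mem_insert, mem_singleton]
    rintro (rfl | rfl | rfl | rfl | rfl)
    · exact (o.hR hr0).2 (hyR _ hr0)
    · exact (o.hA ha1).2 (hx _ ha1).1
    · exact (o.hA ha1).2 (hx _ ha1).2
    · exact (o.hA ha1).2 hz1
    · exact (o.hA ha2).2 hz2
  · rw [card_insert_of_notMem, card_insert_of_notMem, card_insert_of_notMem, card_pair hz]
    · simp only [mem_insert, mem_singleton]; rintro (h | h) <;> [exact hz1y h.symm; exact hz2y h.symm]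
    · simp only [mem_insert, mem_singleton]; rintro (h | h | h) <;> [exact h12 h; exact hz1x h.symm; exact hz2x h.symm]
    · simp only [mem_insert, mem_singleton]; tauto
  · have star : ∀ f, f ∈ H → y ∈ f → z1 ∉ f → z2 ∉ f → f ∈ ((V \ {z1, z2}).powersetCard 3).filter (fun t => y ∈ t) := by
      intro f hf hyf h1 h2
      rw [mem_filter, mem_powersetCard]
      refine ⟨⟨?_, (o.hH f hf).2⟩, hyf⟩
      intro v hv
      simp only [mem_sdiff, mem_insert, mem_singleton]
      refine ⟨(o.hH f hf).1 hv, ?_⟩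
      rintro (rfl | rfl) <;> contradiction
    intro f hf
    have hf0 := hf
    rw [o.eq, mem_union, mem_union] at hf
    rw [mem_union]
    rcases hf with (hf | hf) | hf
    · right
      rw [mem_insert, mem_singleton] at hf
      simp only [mem_insert, mem_singleton]
      rcases hf with rfl | rfl
      · exact Or.inl e1
      · exact Or.inr (Or.inl e2)
    · left
      apply star f hf0 (hyB _ hf)
      · exact not_mem_of_inter (o.AB _ ha1 _ hf) hz1
      · exact not_mem_of_inter (o.AB _ ha2 _ hf) hz2
    · have fc := (o.hR hf).1
      have yf := hyR _ hf
      obtain ⟨p, pf, pa, -⟩ := o.meet hyB ha1 hf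
      obtain ⟨q, qf, qa, -⟩ := o.meet hyB ha2 hf
      rw [e1] at pa
      rw [e2] at qa
      simp only [mem_insert, mem_singleton] at pa qa
      by_cases k1 : z1 ∈ f
      · right
        simp only [mem_insert, mem_singleton]
        rcases qa with rfl | rfl | rfl
        · have := tri_eq fc yf qf k1 yx1 yz1 (Ne.symm hz1x)
          tauto
        · have := tri_eq fc yf qf k1 yx2 yz1 (Ne.symm hz1y)
          tauto
        · have := tri_eq fc yf k1 qf yz1 yz2 hz
          tauto
      · by_cases k2 : z2 ∈ f
        · right
          simp only [mem_insert, mem_singleton]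
          rcases pa with rfl | rfl | rfl
          · have := tri_eq fc yf pf k2 yx1 yz2 (Ne.symm hz2x)
            tauto
          · have := tri_eq fc yf pf k2 yx2 yz2 (Ne.symm hz2y)
            tauto
          · exact absurd pf k1
        · exact Or.inl (star f hf0 yf k1 k2)

theorem case1 (o : OS V H A B R n) {x1 x2 : ℕ} (h12 : x1 ≠ x2) (hx : ∀ a ∈ A, x1 ∈ a ∧ x2 ∈ a)
    (hcd : A.card = 1 ∨ 2 ≤ B.card) (hns : ¬SubStarPlus V H) (hncb : ¬SubCB V H) :
    H.card ≤ 4 * n - 11 ∨ H.card ≤ (n - 4).choose 2 + 10 := by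
  have hn := o.hn
  have hAs : A.card ≤ (A.biUnion id).card - 2 := pair_count' h12 (fun e he => ⟨(o.hA he).1, subX he, hx e he⟩)
  have hst := o.st
  by_cases hno : ∀ y, ∃ e ∈ B ∪ R, y ∉ e
  · left
    have h1 := hm o.hn o.hV (F := B ∪ R) (fun e he => by
      rcases mem_union.1 he with h | h
      · exact o.hB h
      · exact o.hR h) o.intBR hno
    have h2 := o.card2
    rcases hcd with h | h
    · omega
    · have := o.symm.s4 h
      omega
  · push Not at hno
    obtain ⟨y, hy⟩ := hno
    have hyB : ∀ b ∈ B, y ∈ b := fun b hb => hy b (mem_union_left _ hb)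
    have hyR : ∀ b ∈ R, y ∈ b := fun b hb => hy b (mem_union_right _ hb)
    obtain ⟨r0, hr0⟩ := o.Rn
    have hA1 : A.card ≠ 1 := by
      intro h
      obtain ⟨a, rfl⟩ := card_eq_one.1 h
      have ha : a ∈ ({a} : Finset (Finset ℕ)) := by simp
      apply hns
      apply starplus_of o.hH ((o.hR hr0).2 (hyR _ hr0)) (o.hA ha).2 (o.hA ha).1 (o.yA hyB ha)
      intro f hf
      rw [o.eq, mem_union, mem_union] at hf
      rcases hf with (hf | hf) | hf
      · exact Or.inr (mem_singleton.1 hf)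
      · exact Or.inl (hyB f hf)
      · exact Or.inl (hyR f hf)
    have hA2 : A.card ≠ 2 := fun h => hncb (o.cb_case h12 hx hyB hyR h)
    have hA0 : A.card ≠ 0 := by
      have := card_pos.2 o.An
      omega
    right
    have hB : B.card ≤ ((B.biUnion id).card - 1).choose 2 :=
      star_count (fun e he => ⟨(o.hB he).1, subX he, hyB e he⟩)
    have key : ∀ r ∈ R, x1 ∈ r ∨ x2 ∈ r := by
      intro r hr
      by_contra hc
      push Not at hc
      have : A.card ≤ (r.erase y).card * 1 := by
        apply hit_count
        · intro a ha
          obtain ⟨z, z1, z2, z3⟩ := o.meet hyB ha hr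
          exact ⟨z, mem_inter.2 ⟨z2, mem_erase.2 ⟨z3, z1⟩⟩⟩
        · intro z hz
          apply uniq_count (p := x1) (q := x2) (z := z) h12
          · rintro rfl; exact hc.1 (mem_erase.1 hz).2
          · rintro rfl; exact hc.2 (mem_erase.1 hz).2
          · intro a ha
            rw [mem_filter] at ha
            exact ⟨(o.hA ha.1).1, (hx a ha.1).1, (hx a ha.1).2, ha.2⟩
      rw [card_erase_of_mem (hyR r hr), (o.hR hr).1] at this
      omega
    obtain ⟨a, ha⟩ := o.An
    have hR : R.card ≤ 2 * (n - 2) := by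
      have hs : R ⊆ R.filter (fun r => x1 ∈ r) ∪ R.filter (fun r => x2 ∈ r) := by
        intro r hr
        simp only [mem_union, mem_filter, hr, true_and]
        exact key r hr
      have c1 : (R.filter (fun r => x1 ∈ r)).card ≤ V.card - 2 := by
        apply pair_count' (a := y) (b := x1)
        · rintro rfl; exact o.yA hyB ha (hx a ha).1
        · intro r hr
          rw [mem_filter] at hr
          exact ⟨(o.hR hr.1).1, (o.hR hr.1).2, hyR r hr.1, hr.2⟩
      have c2 : (R.filter (fun r => x2 ∈ r)).card ≤ V.card - 2 := by
        apply pair_count' (a := y) (b := x2)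
        · rintro rfl; exact o.yA hyB ha (hx a ha).2
        · intro r hr
          rw [mem_filter] at hr
          exact ⟨(o.hR hr.1).1, (o.hR hr.1).2, hyR r hr.1, hr.2⟩
      have := (card_le_card hs).trans (card_union_le _ _)
      rw [o.hV] at c1 c2
      omega
    have hc := o.card3
    have := arith1 (show 5 ≤ (A.biUnion id).card by omega) o.symm.s3 hst
    omega

theorem cross (o : OS V H A B R n) {r : Finset ℕ} (hr : r ∈ R) :
    (∃ x ∈ r, ∀ a ∈ A, x ∈ a) ∨ ∃ y ∈ r, ∀ b ∈ B, y ∈ b := by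
  by_contra hc
  push Not at hc
  obtain ⟨c1, c2⟩ := hc
  obtain ⟨a, ha⟩ := o.An
  obtain ⟨b, hb⟩ := o.Bn
  obtain ⟨x, hx⟩ := o.AR a ha r hr
  obtain ⟨y, hy⟩ := o.BR b hb r hr
  rw [mem_inter] at hx hy
  obtain ⟨a', ha', hxa'⟩ := c1 x hx.1
  obtain ⟨b', hb', hyb'⟩ := c2 y hy.1
  obtain ⟨x', hx'⟩ := o.AR a' ha' r hr
  obtain ⟨y', hy'⟩ := o.BR b' hb' r hr
  rw [mem_inter] at hx' hy'
  have hxx : x ≠ x' := by rintro rfl; exact hxa' hx'.2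
  have hyy : y ≠ y' := by rintro rfl; exact hyb' hy'.2
  have e1 := ne_of_inter (o.AB a ha b hb) hx.2 hy.2
  have e2 := ne_of_inter (o.AB a ha b' hb') hx.2 hy'.2
  have e3 := ne_of_inter (o.AB a' ha' b hb) hx'.2 hy.2
  have e4 := ne_of_inter (o.AB a' ha' b' hb') hx'.2 hy'.2
  have E := tri_eq (o.hR hr).1 hx.1 hx'.1 hy.1 hxx e1 e3
  have := hy'.1
  rw [E] at this
  simp only [mem_insert, mem_singleton] at this
  rcases this with h | h | h
  · exact e2 h.symm
  · exact e4 h.symm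
  · exact hyy h.symm

theorem two_of (o : OS V H A B R n) (h : ¬∃ x1 x2, x1 ≠ x2 ∧ ∀ a ∈ A, x1 ∈ a ∧ x2 ∈ a) : 2 ≤ A.card := by
  by_contra hc
  have := card_pos.2 o.An
  obtain ⟨a, rfl⟩ := card_eq_one.1 (show A.card = 1 by omega)
  have h3 := (o.hA (mem_singleton_self a)).1
  obtain ⟨x, y, z, hxy, -, -, rfl⟩ := card_eq_three.1 h3
  exact h ⟨x, y, hxy, by simp⟩

theorem case2a (o : OS V H A B R n) {y : ℕ} (hnA : ¬∃ x, ∀ a ∈ A, x ∈ a) (hy : ∀ b ∈ B, y ∈ b)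
    (h2B : ¬∃ x1 x2, x1 ≠ x2 ∧ ∀ a ∈ B, x1 ∈ a ∧ x2 ∈ a) :
    H.card ≤ 4 * n - 11 ∨ H.card ≤ (n - 4).choose 2 + 10 := by
  have hyR : ∀ r ∈ R, y ∈ r := by
    intro r hr
    rcases o.cross hr with ⟨x, -, hx⟩ | ⟨y', hy'r, hy'⟩
    · exact absurd ⟨x, hx⟩ hnA
    · by_contra hc
      exact h2B ⟨y, y', by rintro rfl; exact hc hy'r, fun a ha => ⟨hy a ha, hy' a ha⟩⟩
  have A2 : 2 ≤ A.card := o.two_of (fun ⟨x1, _, _, h⟩ => hnA ⟨x1, fun a ha => (h a ha).1⟩)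
  have B2 : 2 ≤ B.card := o.symm.two_of h2B
  have hno : ∀ x, ∃ e ∈ A, x ∉ e := by
    intro x; by_contra hc; push Not at hc; exact hnA ⟨x, hc⟩
  have cB : B.card ≤ ((B.biUnion id).card - 1).choose 2 :=
    star_count (fun e he => ⟨(o.hB he).1, subX he, hy e he⟩)
  obtain ⟨r, hr⟩ := o.Rn
  obtain ⟨g, h, hgh, hfe⟩ := card_eq_two.1
    (show (r.erase y).card = 2 by rw [card_erase_of_mem (hyR r hr), (o.hR hr).1])
  have hcov : ∀ a ∈ A, g ∈ a ∨ h ∈ a := by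
    intro a ha
    obtain ⟨z, z1, z2, z3⟩ := o.meet hy ha hr
    have : z ∈ r.erase y := mem_erase.2 ⟨z3, z1⟩
    rw [hfe, mem_insert, mem_singleton] at this
    rcases this with rfl | rfl
    · exact Or.inl z2
    · exact Or.inr z2
  have hh : h ∈ A.biUnion id := by
    obtain ⟨a, ha, hga⟩ := hno g
    exact subX ha ((hcov a ha).resolve_left hga)
  have hg : g ∈ A.biUnion id := by
    obtain ⟨a, ha, hga⟩ := hno h
    exact subX ha ((hcov a ha).resolve_right hga)
  have cA : A.card ≤ 3 * (A.biUnion id).card - 5 :=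
    hm2 hgh hg hh (fun e he => ⟨(o.hA he).1, subX he⟩) o.Ai hno hcov
  obtain ⟨a, ha⟩ := o.An
  have cR : R.card ≤ a.card * (3 * 1) := by
    apply hit_count (fun f hf => o.AR a ha f hf)
    intro z hz
    obtain ⟨a', ha', hza'⟩ := hno z
    rw [← (o.hA ha').1]
    apply hit_count (fun f hf => o.AR a' ha' f (mem_filter.1 hf).1)
    intro z' hz'
    apply uniq_count (p := y) (q := z) (z := z')
    · rintro rfl; exact o.yA hy ha hz
    · rintro rfl; exact o.yA hy ha' hz'
    · rintro rfl; exact hza' hz'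
    · intro f hf
      rw [mem_filter, mem_filter] at hf
      exact ⟨(o.hR hf.1.1).1, hyR f hf.1.1, hf.1.2, hf.2⟩
  rw [(o.hA ha).1] at cR
  have := arith2 (o.s4 A2) (o.symm.s4 B2) o.st
  have := o.card3
  omega

theorem half (o : OS V H A B R n) {x y : ℕ} (hx : ∀ a ∈ A, x ∈ a) (hy : ∀ b ∈ B, y ∈ b)
    (h2A : ¬∃ x1 x2, x1 ≠ x2 ∧ ∀ a ∈ A, x1 ∈ a ∧ x2 ∈ a) :
    A.card + (R.filter (fun r => y ∈ r ∧ x ∉ r)).card ≤ ((A.biUnion id).card - 1).choose 2 ∨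
    A.card + (R.filter (fun r => y ∈ r ∧ x ∉ r)).card ≤ 2 * (A.biUnion id).card - 1 := by
  set Q := R.filter (fun r => y ∈ r ∧ x ∉ r) with hQ
  have hQm : ∀ r ∈ Q, r ∈ R ∧ y ∈ r ∧ x ∉ r := fun r hr => mem_filter.1 hr
  have hno : ∀ z, z ≠ x → ∃ e ∈ A, z ∉ e := by
    intro z hz; by_contra hc; push Not at hc; exact h2A ⟨z, x, hz, fun a ha => ⟨hc a ha, hx a ha⟩⟩
  rcases Q.eq_empty_or_nonempty with h0 | ⟨r, hr⟩
  · left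
    rw [h0, card_empty, add_zero]
    exact star_count (fun e he => ⟨(o.hA he).1, subX he, hx e he⟩)
  right
  obtain ⟨hrR, yr, xr⟩ := hQm r hr
  obtain ⟨g, h, hgh, hfe⟩ := card_eq_two.1
    (show (r.erase y).card = 2 by rw [card_erase_of_mem yr, (o.hR hrR).1])
  have gr : g ∈ r := mem_of_mem_erase (show g ∈ r.erase y by rw [hfe]; simp)
  have hr' : h ∈ r := mem_of_mem_erase (show h ∈ r.erase y by rw [hfe]; simp)
  have xg : x ≠ g := by rintro rfl; exact xr gr
  have xh : x ≠ h := by rintro rfl; exact xr hr'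
  have hcov : ∀ a ∈ A, g ∈ a ∨ h ∈ a := by
    intro a ha
    obtain ⟨z, z1, z2, z3⟩ := o.meet hy ha hrR
    have : z ∈ r.erase y := mem_erase.2 ⟨z3, z1⟩
    rw [hfe, mem_insert, mem_singleton] at this
    rcases this with rfl | rfl
    · exact Or.inl z2
    · exact Or.inr z2
  have hg : g ∈ A.biUnion id := by
    obtain ⟨a, ha, hga⟩ := hno h xh.symm
    exact subX ha ((hcov a ha).resolve_right hga)
  have c1 : (A.filter (fun a => g ∈ a)).card ≤ (A.biUnion id).card - 2 := by
    apply pair_count' xg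
    intro a ha
    rw [mem_filter] at ha
    exact ⟨(o.hA ha.1).1, subX ha.1, hx a ha.1, ha.2⟩
  have c2 : (A.filter (fun a => g ∉ a)).card ≤ ((A.biUnion id).erase g).card - 2 := by
    apply pair_count' xh
    intro a ha
    rw [mem_filter] at ha
    exact ⟨(o.hA ha.1).1, subset_erase.2 ⟨subX ha.1, ha.2⟩, hx a ha.1, (hcov a ha.1).resolve_left ha.2⟩
  rw [card_erase_of_mem hg] at c2
  have c3 := card_filter_add_card_filter_not (s := A) (fun a => g ∈ a)
  obtain ⟨a, ha⟩ := o.An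
  have cQ : Q.card ≤ (a.erase x).card * (2 * 1) := by
    apply hit_count
    · intro f hf
      obtain ⟨z, z1, z2, z3⟩ := o.meet hy ha (hQm f hf).1
      exact ⟨z, mem_inter.2 ⟨z1, mem_erase.2 ⟨fun h => (hQm f hf).2.2 (h ▸ z1), z2⟩⟩⟩
    intro z hz
    rw [mem_erase] at hz
    obtain ⟨a', ha', hza'⟩ := hno z hz.1
    rw [← show (a'.erase x).card = 2 by rw [card_erase_of_mem (hx a' ha'), (o.hA ha').1]]
    apply hit_count
    · intro f hf
      have hf' := hQm f (mem_filter.1 hf).1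
      obtain ⟨z, z1, z2, z3⟩ := o.meet hy ha' hf'.1
      exact ⟨z, mem_inter.2 ⟨z1, mem_erase.2 ⟨fun h => hf'.2.2 (h ▸ z1), z2⟩⟩⟩
    intro z' hz'
    rw [mem_erase] at hz'
    apply uniq_count (p := y) (q := z) (z := z')
    · rintro rfl; exact o.yA hy ha hz.2
    · rintro rfl; exact o.yA hy ha' hz'.2
    · rintro rfl; exact hza' hz'.2
    · intro f hf
      have hf1 := mem_filter.1 hf
      have hf2 := mem_filter.1 hf1.1
      have hf3 := hQm f hf2.1
      exact ⟨(o.hR hf3.1).1, hf3.2.1, hf2.2, hf1.2⟩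
  rw [card_erase_of_mem (hx a ha), (o.hA ha).1] at cQ
  have := o.s3
  omega

theorem case2b (o : OS V H A B R n) {x y : ℕ} (hx : ∀ a ∈ A, x ∈ a) (hy : ∀ b ∈ B, y ∈ b)
    (h2A : ¬∃ x1 x2, x1 ≠ x2 ∧ ∀ a ∈ A, x1 ∈ a ∧ x2 ∈ a)
    (h2B : ¬∃ x1 x2, x1 ≠ x2 ∧ ∀ a ∈ B, x1 ∈ a ∧ x2 ∈ a) :
    H.card ≤ 4 * n - 11 ∨ H.card ≤ (n - 4).choose 2 + 10 := by
  have hn := o.hn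
  have s4 := o.s4 (o.two_of h2A)
  have t4 := o.symm.s4 (o.symm.two_of h2B)
  have st := o.st
  have p := o.half hx hy h2A
  have q := o.symm.half hy hx h2B
  have hc := o.card3
  obtain ⟨a, ha⟩ := o.An
  have hxy : x ≠ y := by rintro rfl; exact o.yA hy ha (hx a ha)
  have c0 : (R.filter (fun r => x ∈ r ∧ y ∈ r)).card ≤ V.card - 2 := by
    apply pair_count' hxy
    intro e he
    rw [mem_filter] at he
    exact ⟨(o.hR he.1).1, (o.hR he.1).2, he.2.1, he.2.2⟩
  rw [o.hV] at c0
  have hsub : R ⊆ R.filter (fun r => x ∈ r ∧ y ∈ r) ∪ (R.filter (fun r => y ∈ r ∧ x ∉ r) ∪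
      R.filter (fun r => x ∈ r ∧ y ∉ r)) := by
    intro r hr
    have : x ∈ r ∨ y ∈ r := by
      rcases o.cross hr with ⟨x', hr', hx'⟩ | ⟨y', hr', hy'⟩
      · left
        by_contra hc
        exact h2A ⟨x, x', by rintro rfl; exact hc hr', fun a ha => ⟨hx a ha, hx' a ha⟩⟩
      · right
        by_contra hc
        exact h2B ⟨y, y', by rintro rfl; exact hc hr', fun a ha => ⟨hy a ha, hy' a ha⟩⟩
    simp only [mem_union, mem_filter, hr, true_and]
    tauto
  have hR := (card_le_card hsub).trans ((card_union_le _ _).trans (Nat.add_le_add_left (card_union_le _ _) _))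
  have r1 := arith3 s4 t4 st
  have r2 := arith3 t4 s4 o.symm.st
  have r3 := arith4 s4 t4 st
  omega

theorem main (o : OS V H A B R n) (hns : ¬SubStarPlus V H) (hncb : ¬SubCB V H) :
    H.card ≤ 4 * n - 11 ∨ H.card ≤ (n - 4).choose 2 + 10 := by
  by_cases h2A : ∃ x1 x2, x1 ≠ x2 ∧ ∀ a ∈ A, x1 ∈ a ∧ x2 ∈ a
  · obtain ⟨x1, x2, h12, hx⟩ := h2A
    by_cases hcd : A.card = 1 ∨ 2 ≤ B.card
    · exact o.case1 h12 hx hcd hns hncb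
    · have h2B : ∃ x1 x2, x1 ≠ x2 ∧ ∀ a ∈ B, x1 ∈ a ∧ x2 ∈ a := by
        by_contra h
        exact hcd (Or.inr (o.symm.two_of h))
      obtain ⟨x1, x2, h12, hx⟩ := h2B
      have := card_pos.2 o.Bn
      exact o.symm.case1 h12 hx (by omega) hns hncb
  · by_cases h2B : ∃ x1 x2, x1 ≠ x2 ∧ ∀ a ∈ B, x1 ∈ a ∧ x2 ∈ a
    · obtain ⟨x1, x2, h12, hx⟩ := h2B
      exact o.symm.case1 h12 hx (Or.inr (o.two_of h2A)) hns hncb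
    · by_cases hA : ∃ x, ∀ a ∈ A, x ∈ a
      · obtain ⟨x, hx⟩ := hA
        by_cases hB : ∃ x, ∀ a ∈ B, x ∈ a
        · obtain ⟨y, hy⟩ := hB
          exact o.case2b hx hy h2A h2B
        · exact o.symm.case2a hB hx h2A
      · by_cases hB : ∃ x, ∀ a ∈ B, x ∈ a
        · obtain ⟨y, hy⟩ := hB
          exact o.case2a hA hy h2B
        · exfalso
          obtain ⟨r, hr⟩ := o.Rn
          rcases o.cross hr with ⟨x, -, hx⟩ | ⟨y, -, hy⟩
          · exact hA ⟨x, hx⟩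
          · exact hB ⟨y, hy⟩

end OS

theorem mkOS {V : Finset ℕ} {H : Finset (Finset ℕ)} {n : ℕ} (hn : 8 ≤ n) (hV : V.card = n)
    (hH : ThreeGraphOn V H) (hconn : ConnectedHG V H) (h1 : D1 H) {e f : Finset ℕ} (he : e ∈ H) (hf : f ∈ H)
    (hef : e ∩ f = ∅)
    (hO : ∀ r ∈ H, ∀ r' ∈ H, r ∩ r' = ∅ → e ∩ r ≠ ∅ → e ∩ r' ≠ ∅ → f ∩ r ≠ ∅ → f ∩ r' ≠ ∅ → False) :
    OS V H (H.filter (fun g => g ∩ f = ∅)) (H.filter (fun g => g ∩ e = ∅))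
      (H.filter (fun g => g ∩ f ≠ ∅ ∧ g ∩ e ≠ ∅)) n := by
  have hfe : f ∩ e = ∅ := by rw [inter_comm]; exact hef
  have nself : ∀ a ∈ H, a ∩ a ≠ ∅ := by
    intro a ha h
    rw [inter_self] at h
    have := (hH a ha).2
    rw [h] at this; simp at this
  have AB : ∀ a ∈ H.filter (fun g => g ∩ f = ∅), ∀ b ∈ H.filter (fun g => g ∩ e = ∅), a ∩ b = ∅ := by
    intro a ha b hb
    rw [mem_filter] at ha hb
    exact h1 a ha.1 f hf e he b hb.1 ha.2 hfe (by rw [inter_comm]; exact hb.2)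
  have eA : e ∈ H.filter (fun g => g ∩ f = ∅) := mem_filter.2 ⟨he, hef⟩
  have fB : f ∈ H.filter (fun g => g ∩ e = ∅) := mem_filter.2 ⟨hf, hfe⟩
  have heq : H = H.filter (fun g => g ∩ f = ∅) ∪ H.filter (fun g => g ∩ e = ∅) ∪
      H.filter (fun g => g ∩ f ≠ ∅ ∧ g ∩ e ≠ ∅) := by
    ext g
    simp only [mem_union, mem_filter]
    tauto
  refine ⟨hn, hV, hH, heq, AB, ?_, ?_, ?_, ?_, ?_, ⟨e, eA⟩, ⟨f, fB⟩, ?_⟩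
  · intro a ha b hb
    rw [mem_filter] at ha hb
    rw [nonempty_iff_ne_empty]
    intro h
    exact nself a ha.1 (h1 a ha.1 b hb.1 f hf a ha.1 h hb.2 (by rw [inter_comm]; exact ha.2))
  · intro a ha b hb
    rw [mem_filter] at ha hb
    rw [nonempty_iff_ne_empty]
    intro h
    exact nself a ha.1 (h1 a ha.1 b hb.1 e he a ha.1 h hb.2 (by rw [inter_comm]; exact ha.2))
  · intro a ha b hb
    rw [mem_filter] at ha hb
    rw [nonempty_iff_ne_empty]
    intro h
    refine hO a ha.1 b hb.1 h ?_ ?_ ?_ ?_ <;> rw [inter_comm] <;> tauto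
  · intro a ha r hr
    rw [mem_filter] at ha hr
    rw [nonempty_iff_ne_empty]
    intro h
    exact hr.2.2 (h1 r hr.1 a ha.1 f hf e he h ha.2 hfe)
  · intro a ha r hr
    rw [mem_filter] at ha hr
    rw [nonempty_iff_ne_empty]
    intro h
    exact hr.2.1 (h1 r hr.1 a ha.1 e he f hf h ha.2 hef)
  · set A := H.filter (fun g => g ∩ f = ∅) with hA
    have hAf : ∀ x ∈ A.biUnion id, ∀ b ∈ H.filter (fun g => g ∩ e = ∅), x ∉ b := by
      intro x hx b hb
      simp only [mem_biUnion, id] at hx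
      obtain ⟨a, ha, xa⟩ := hx
      exact not_mem_of_inter (AB a ha b hb) xa
    have ne3 : ∀ a ∈ H, a.Nonempty := fun a ha => card_pos.1 (by rw [(hH a ha).2]; omega)
    obtain ⟨z, hz⟩ := ne3 e he
    obtain ⟨w, hw⟩ := ne3 f hf
    obtain ⟨r, hr, ⟨p, hp⟩, ⟨q, hq⟩⟩ := hconn (A.biUnion id) (V \ A.biUnion id)
      (union_sdiff_of_subset (by
        intro x hx
        simp only [mem_biUnion, id] at hx
        obtain ⟨a, ha, xa⟩ := hx
        exact (hH a (mem_filter.1 ha).1).1 xa)) disjoint_sdiff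
      ⟨z, OS.subX eA hz⟩ ⟨w, mem_sdiff.2 ⟨(hH f hf).1 hw, fun h => hAf w h f fB hw⟩⟩
    rw [mem_inter] at hp hq
    rw [mem_sdiff] at hq
    refine ⟨r, mem_filter.2 ⟨hr, ?_, ?_⟩⟩
    · intro h
      exact hq.2.2 (OS.subX (mem_filter.2 ⟨hr, h⟩) hq.1)
    · intro h
      exact hAf p hp.2 r (mem_filter.2 ⟨hr, h⟩) hp.1

theorem final (n : ℕ) (hn : 8 ≤ n)
    (V : Finset ℕ) (H : Finset (Finset ℕ)) (hV : V.card = n)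
    (hH : ThreeGraphOn V H) (hconn : ConnectedHG V H) (hfree : P4Free H)
    (hC4 : ¬HasC4 H) (hM3 : ¬HasM3 H)
    (hns : ¬SubStarPlus V H) (hnsp : ¬SubSP V H) (hncb : ¬SubCB V H) :
    H.card ≤ max (4 * n - 11) ((n - 4).choose 2 + 10) := by
  have h1 := mkD1 hfree hM3
  have h3 := mkD3 (fun e he => (hH e he).2) hC4
  rw [le_max_iff]
  by_cases hi : IntF H
  · rcases case_O0 hn hV hH hi with h | h
    · exact absurd h hns
    · exact Or.inl h
  · unfold IntF at hi
    push Not at hi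
    obtain ⟨e, he, f, hf, hef⟩ := hi
    by_cases hM : ∃ r ∈ H, ∃ r' ∈ H, r ∩ r' = ∅ ∧ e ∩ r ≠ ∅ ∧ e ∩ r' ≠ ∅ ∧ f ∩ r ≠ ∅ ∧ f ∩ r' ≠ ∅
    · obtain ⟨r, hr, r', hr', d, a1, a2, a3, a4⟩ := hM
      rcases case_M hn hV hH h1 h3 he hf hr hr' hef d a1 a2 a3 a4 with h | h
      · exact Or.inl h
      · exact absurd h hnsp
    · exact (mkOS hn hV hH hconn h1 he hf hef (fun r hr r' hr' d a1 a2 a3 a4 =>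
        hM ⟨r, hr, r', hr', d, a1, a2, a3, a4⟩)).main hns hncb

/-- Lemma 3.2: a connected `{𝒫₄, C₄, M₃}`-free 3-graph on `n ≥ 8` vertices
which is a sub-3-graph of none of `Sₙ⁺¹`, `SPₙ`, `CBₙ` has at most
`max{4n - 11, C(n-4,2) + 10}` edges. -/
theorem lemma_nu2 (n : ℕ) (hn : 8 ≤ n)
    (V : Finset ℕ) (H : Finset (Finset ℕ)) (hV : V.card = n)
    (hH : ThreeGraphOn V H) (hconn : ConnectedHG V H) (hfree : P4Free H)
    (hC4 : ¬HasC4 H) (hM3 : ¬HasM3 H)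
    (hns : ¬SubStarPlus V H) (hnsp : ¬SubSP V H) (hncb : ¬SubCB V H) :
    H.card ≤ max (4 * n - 11) ((n - 4).choose 2 + 10) := by
  exact final n hn V H hV hH hconn hfree hC4 hM3 hns hnsp hncb
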